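/- arXiv:1207.3849 — 3 statements merged into one kernel-verified Lean document; each statement's English description precedes it below -/
import Mathlib

section
/- A unit vector v ∈ H₃ is uniquely determined up to local unitaries by the spectra of its one-qubit reduced density matrices (i.e., every unit vector w ∈ H₃ with p_i(w) = p_i(v) for i = 1,2,3 is LU-equivalent to v) if and only if (p₁(v),p₂(v),p₃(v)) lies on the boundary of the Kirwan polytope, i.e., if and only if p_i(v) = 1/2 for some i or p_i(v) = p_j(v) + p_k(v) for some permutation (i,j,k) of (1,2,3). -/
open scoped BigOperators

/-- The three-qubit Hilbert space. -/
abbrev H3 := (Fin 2 × Fin 2 × Fin 2) → ℂ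

/-- Squared Hermitian norm of a vector in `H3`. -/
noncomputable def normSq3 (v : H3) : ℝ := ∑ x : Fin 2 × Fin 2 × Fin 2, Complex.normSq (v x)

/-- First one-qubit reduced density matrix. -/
noncomputable def rho1 (v : H3) : Matrix (Fin 2) (Fin 2) ℂ :=
  Matrix.of fun a a' => ∑ b : Fin 2, ∑ c : Fin 2, v (a, b, c) * star (v (a', b, c))

/-- Second one-qubit reduced density matrix. -/
noncomputable def rho2 (v : H3) : Matrix (Fin 2) (Fin 2) ℂ :=
  Matrix.of fun b b' => ∑ a : Fin 2, ∑ c : Fin 2, v (a, b, c) * star (v (a, b', c))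

/-- Third one-qubit reduced density matrix. -/
noncomputable def rho3 (v : H3) : Matrix (Fin 2) (Fin 2) ℂ :=
  Matrix.of fun c c' => ∑ a : Fin 2, ∑ b : Fin 2, v (a, b, c) * star (v (a, b, c'))

/-- Minimal (real) eigenvalue of a 2×2 complex matrix. -/
noncomputable def minEig (ρ : Matrix (Fin 2) (Fin 2) ℂ) : ℝ :=
  sInf {t : ℝ | (t : ℂ) ∈ spectrum ℂ ρ}

noncomputable def p1 (v : H3) : ℝ := minEig (rho1 v)
noncomputable def p2 (v : H3) : ℝ := minEig (rho2 v)
noncomputable def p3 (v : H3) : ℝ := minEig (rho3 v)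

/-- The action of a triple of 2×2 matrices on `H3` by the tensor product. -/
noncomputable def tensor3 (A1 A2 A3 : Matrix (Fin 2) (Fin 2) ℂ) (v : H3) : H3 :=
  fun x => ∑ a' : Fin 2, ∑ b' : Fin 2, ∑ c' : Fin 2,
    A1 x.1 a' * A2 x.2.1 b' * A3 x.2.2 c' * v (a', b', c')

/-- Local unitary equivalence of three-qubit states. -/
def LUequiv (v w : H3) : Prop :=
  ∃ U1 U2 U3 : Matrix (Fin 2) (Fin 2) ℂ,
    U1 ∈ Matrix.unitaryGroup (Fin 2) ℂ ∧ U2 ∈ Matrix.unitaryGroup (Fin 2) ℂ ∧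
    U3 ∈ Matrix.unitaryGroup (Fin 2) ℂ ∧ w = tensor3 U1 U2 U3 v

/-- The three-qubit W state. -/
noncomputable def wState : H3 := fun x =>
  if (x.1 = 1 ∧ x.2.1 = 0 ∧ x.2.2 = 0) ∨ (x.1 = 0 ∧ x.2.1 = 1 ∧ x.2.2 = 0) ∨
      (x.1 = 0 ∧ x.2.1 = 0 ∧ x.2.2 = 1)
  then ((1 / Real.sqrt 3 : ℝ) : ℂ) else 0

/-- The SLOCC class of the W state. -/
def WClass : Set H3 :=
  {v | ∃ (A1 A2 A3 : Matrix (Fin 2) (Fin 2) ℂ) (l : ℂ),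
    A1.det = 1 ∧ A2.det = 1 ∧ A3.det = 1 ∧ l ≠ 0 ∧ v = l • tensor3 A1 A2 A3 wState}


/-! ### Single-site actions -/

/-- Action of a matrix on the first tensor factor. -/
noncomputable def act1 (A : Matrix (Fin 2) (Fin 2) ℂ) (v : H3) : H3 :=
  fun x => A x.1 0 * v (0, x.2.1, x.2.2) + A x.1 1 * v (1, x.2.1, x.2.2)

/-- Action of a matrix on the second tensor factor. -/
noncomputable def act2 (A : Matrix (Fin 2) (Fin 2) ℂ) (v : H3) : H3 :=
  fun x => A x.2.1 0 * v (x.1, 0, x.2.2) + A x.2.1 1 * v (x.1, 1, x.2.2)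

/-- Action of a matrix on the third tensor factor. -/
noncomputable def act3 (A : Matrix (Fin 2) (Fin 2) ℂ) (v : H3) : H3 :=
  fun x => A x.2.2 0 * v (x.1, x.2.1, 0) + A x.2.2 1 * v (x.1, x.2.1, 1)

lemma tensor3_eq (A B C : Matrix (Fin 2) (Fin 2) ℂ) (v : H3) :
    tensor3 A B C v = act1 A (act2 B (act3 C v)) := by
  ext ⟨a, b, c⟩
  simp only [tensor3, act1, act2, act3, Fin.sum_univ_two]
  ring

lemma act1_one (v : H3) : act1 1 v = v := by
  ext ⟨a, b, c⟩
  have h : ∀ i : Fin 2, (1 : Matrix (Fin 2) (Fin 2) ℂ) i 0 * v (0, b, c) +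
      (1 : Matrix (Fin 2) (Fin 2) ℂ) i 1 * v (1, b, c) = v (i, b, c) := by
    rw [Fin.forall_fin_two]; simp
  exact h a

lemma act2_one (v : H3) : act2 1 v = v := by
  ext ⟨a, b, c⟩
  have h : ∀ i : Fin 2, (1 : Matrix (Fin 2) (Fin 2) ℂ) i 0 * v (a, 0, c) +
      (1 : Matrix (Fin 2) (Fin 2) ℂ) i 1 * v (a, 1, c) = v (a, i, c) := by
    rw [Fin.forall_fin_two]; simp
  exact h b

lemma act3_one (v : H3) : act3 1 v = v := by
  ext ⟨a, b, c⟩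
  have h : ∀ i : Fin 2, (1 : Matrix (Fin 2) (Fin 2) ℂ) i 0 * v (a, b, 0) +
      (1 : Matrix (Fin 2) (Fin 2) ℂ) i 1 * v (a, b, 1) = v (a, b, i) := by
    rw [Fin.forall_fin_two]; simp
  exact h c

lemma act1_mul (A B : Matrix (Fin 2) (Fin 2) ℂ) (v : H3) :
    act1 (A * B) v = act1 A (act1 B v) := by
  ext ⟨a, b, c⟩
  simp only [act1, Matrix.mul_apply, Fin.sum_univ_two]
  ring

lemma act2_mul (A B : Matrix (Fin 2) (Fin 2) ℂ) (v : H3) :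
    act2 (A * B) v = act2 A (act2 B v) := by
  ext ⟨a, b, c⟩
  simp only [act2, Matrix.mul_apply, Fin.sum_univ_two]
  ring

lemma act3_mul (A B : Matrix (Fin 2) (Fin 2) ℂ) (v : H3) :
    act3 (A * B) v = act3 A (act3 B v) := by
  ext ⟨a, b, c⟩
  simp only [act3, Matrix.mul_apply, Fin.sum_univ_two]
  ring

lemma act12 (A B : Matrix (Fin 2) (Fin 2) ℂ) (v : H3) :
    act2 B (act1 A v) = act1 A (act2 B v) := by
  ext ⟨a, b, c⟩
  simp only [act1, act2]
  ring

lemma act13 (A B : Matrix (Fin 2) (Fin 2) ℂ) (v : H3) :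
    act3 B (act1 A v) = act1 A (act3 B v) := by
  ext ⟨a, b, c⟩
  simp only [act1, act3]
  ring

lemma act23 (A B : Matrix (Fin 2) (Fin 2) ℂ) (v : H3) :
    act3 B (act2 A v) = act2 A (act3 B v) := by
  ext ⟨a, b, c⟩
  simp only [act2, act3]
  ring

lemma tensor3_mul (A B C A' B' C' : Matrix (Fin 2) (Fin 2) ℂ) (v : H3) :
    tensor3 A B C (tensor3 A' B' C' v) = tensor3 (A * A') (B * B') (C * C') v := by
  simp only [tensor3_eq, act1_mul, act2_mul, act3_mul, act12, act13, act23]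

lemma LUequiv.trans {u v w : H3} (h : LUequiv u v) (h' : LUequiv v w) : LUequiv u w := by
  obtain ⟨A, B, C, hA, hB, hC, rfl⟩ := h
  obtain ⟨A', B', C', hA', hB', hC', rfl⟩ := h'
  exact ⟨A' * A, B' * B, C' * C, mul_mem hA' hA, mul_mem hB' hB, mul_mem hC' hC,
    tensor3_mul _ _ _ _ _ _ _⟩

lemma LUequiv.symm {u v : H3} (h : LUequiv u v) : LUequiv v u := by
  obtain ⟨A, B, C, hA, hB, hC, rfl⟩ := h
  refine ⟨star A, star B, star C, Unitary.star_mem hA, Unitary.star_mem hB,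
    Unitary.star_mem hC, ?_⟩
  rw [tensor3_mul, Matrix.mem_unitaryGroup_iff'.1 hA, Matrix.mem_unitaryGroup_iff'.1 hB,
    Matrix.mem_unitaryGroup_iff'.1 hC, tensor3_eq, act3_one, act2_one, act1_one]

lemma LUequiv.refl (v : H3) : LUequiv v v :=
  ⟨1, 1, 1, one_mem _, one_mem _, one_mem _, by rw [tensor3_eq, act3_one, act2_one, act1_one]⟩

lemma LU_act1 {U : Matrix (Fin 2) (Fin 2) ℂ} (hU : U ∈ Matrix.unitaryGroup (Fin 2) ℂ) (v : H3) :
    LUequiv v (act1 U v) :=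
  ⟨U, 1, 1, hU, one_mem _, one_mem _, by rw [tensor3_eq, act3_one, act2_one]⟩

lemma LU_act2 {U : Matrix (Fin 2) (Fin 2) ℂ} (hU : U ∈ Matrix.unitaryGroup (Fin 2) ℂ) (v : H3) :
    LUequiv v (act2 U v) :=
  ⟨1, U, 1, one_mem _, hU, one_mem _, by rw [tensor3_eq, act3_one, act1_one]⟩

lemma LU_act3 {U : Matrix (Fin 2) (Fin 2) ℂ} (hU : U ∈ Matrix.unitaryGroup (Fin 2) ℂ) (v : H3) :
    LUequiv v (act3 U v) :=
  ⟨1, 1, U, one_mem _, one_mem _, hU, by rw [tensor3_eq, act2_one, act1_one]⟩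

/-! ### Swapping qubits -/

/-- Exchange of the first two qubits. -/
def sw12 (v : H3) : H3 := fun x => v (x.2.1, x.1, x.2.2)

/-- Exchange of the first and third qubits. -/
def sw13 (v : H3) : H3 := fun x => v (x.2.2, x.2.1, x.1)

lemma sw12_sw12 (v : H3) : sw12 (sw12 v) = v := rfl
lemma sw13_sw13 (v : H3) : sw13 (sw13 v) = v := rfl

lemma sw12_act1 (A : Matrix (Fin 2) (Fin 2) ℂ) (v : H3) : sw12 (act1 A v) = act2 A (sw12 v) := rfl
lemma sw12_act2 (A : Matrix (Fin 2) (Fin 2) ℂ) (v : H3) : sw12 (act2 A v) = act1 A (sw12 v) := rfl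
lemma sw12_act3 (A : Matrix (Fin 2) (Fin 2) ℂ) (v : H3) : sw12 (act3 A v) = act3 A (sw12 v) := rfl
lemma sw13_act1 (A : Matrix (Fin 2) (Fin 2) ℂ) (v : H3) : sw13 (act1 A v) = act3 A (sw13 v) := rfl
lemma sw13_act2 (A : Matrix (Fin 2) (Fin 2) ℂ) (v : H3) : sw13 (act2 A v) = act2 A (sw13 v) := rfl
lemma sw13_act3 (A : Matrix (Fin 2) (Fin 2) ℂ) (v : H3) : sw13 (act3 A v) = act1 A (sw13 v) := rfl

lemma rho1_sw12 (v : H3) : rho1 (sw12 v) = rho2 v := rfl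
lemma rho2_sw12 (v : H3) : rho2 (sw12 v) = rho1 v := rfl
lemma rho3_sw12 (v : H3) : rho3 (sw12 v) = rho3 v := by
  ext c c'
  simp only [rho3, sw12, Matrix.of_apply]
  exact Finset.sum_comm
lemma rho1_sw13 (v : H3) : rho1 (sw13 v) = rho3 v := by
  ext c c'
  simp only [rho1, rho3, sw13, Matrix.of_apply]
  exact Finset.sum_comm
lemma rho3_sw13 (v : H3) : rho3 (sw13 v) = rho1 v := by
  rw [← sw13_sw13 v, rho1_sw13, sw13_sw13]
lemma rho2_sw13 (v : H3) : rho2 (sw13 v) = rho2 v := by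
  ext c c'
  simp only [rho2, sw13, Matrix.of_apply]
  exact Finset.sum_comm

lemma LU_sw12 {v w : H3} (h : LUequiv v w) : LUequiv (sw12 v) (sw12 w) := by
  obtain ⟨A, B, C, hA, hB, hC, rfl⟩ := h
  exact ⟨B, A, C, hB, hA, hC, by
    rw [tensor3_eq, tensor3_eq, sw12_act1, sw12_act2, sw12_act3, act12]⟩

lemma LU_sw13 {v w : H3} (h : LUequiv v w) : LUequiv (sw13 v) (sw13 w) := by
  obtain ⟨A, B, C, hA, hB, hC, rfl⟩ := h
  exact ⟨C, B, A, hC, hB, hA, by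
    rw [tensor3_eq, tensor3_eq, sw13_act1, sw13_act2, sw13_act3, act12, act13, act23]⟩

/-! ### Invariance of reduced density matrices, norm -/

lemma rho2_act1 {U : Matrix (Fin 2) (Fin 2) ℂ} (hU : U ∈ Matrix.unitaryGroup (Fin 2) ℂ) (v : H3) :
    rho2 (act1 U v) = rho2 v := by
  have h := Matrix.mem_unitaryGroup_iff'.1 hU
  have h00 := congrFun (congrFun h 0) 0
  have h01 := congrFun (congrFun h 0) 1
  have h10 := congrFun (congrFun h 1) 0
  have h11 := congrFun (congrFun h 1) 1
  simp only [Matrix.mul_apply, Fin.sum_univ_two, Matrix.star_apply, Matrix.one_apply_eq,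
    Matrix.one_apply_ne, ne_eq, zero_ne_one, one_ne_zero, not_false_eq_true] at h00 h01 h10 h11
  ext b b'
  simp only [rho2, act1, Matrix.of_apply, Fin.sum_univ_two, star_add, star_mul']
  linear_combination
    (v (0, b, 0) * star (v (0, b', 0)) + v (0, b, 1) * star (v (0, b', 1))) * h00 +
    (v (1, b, 0) * star (v (0, b', 0)) + v (1, b, 1) * star (v (0, b', 1))) * h01 +
    (v (0, b, 0) * star (v (1, b', 0)) + v (0, b, 1) * star (v (1, b', 1))) * h10 +
    (v (1, b, 0) * star (v (1, b', 0)) + v (1, b, 1) * star (v (1, b', 1))) * h11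

lemma rho1_act1 (U : Matrix (Fin 2) (Fin 2) ℂ) (v : H3) :
    rho1 (act1 U v) = U * rho1 v * star U := by
  ext a a'
  simp only [rho1, act1, Matrix.of_apply, Fin.sum_univ_two, star_add, star_mul',
    Matrix.mul_apply, Matrix.star_apply]
  ring

/-- exchange of the last two qubits -/
def sw23 (v : H3) : H3 := fun x => v (x.1, x.2.2, x.2.1)

lemma rho3_act1 {U : Matrix (Fin 2) (Fin 2) ℂ} (hU : U ∈ Matrix.unitaryGroup (Fin 2) ℂ) (v : H3) :
    rho3 (act1 U v) = rho3 v := rho2_act1 hU (sw23 v)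

lemma rho1_act2 {U : Matrix (Fin 2) (Fin 2) ℂ} (hU : U ∈ Matrix.unitaryGroup (Fin 2) ℂ) (v : H3) :
    rho1 (act2 U v) = rho1 v := by
  rw [← rho2_sw12, sw12_act2, rho2_act1 hU, rho2_sw12]

lemma rho3_act2 {U : Matrix (Fin 2) (Fin 2) ℂ} (hU : U ∈ Matrix.unitaryGroup (Fin 2) ℂ) (v : H3) :
    rho3 (act2 U v) = rho3 v := by
  rw [← rho3_sw12, sw12_act2, rho3_act1 hU, rho3_sw12]

lemma rho1_act3 {U : Matrix (Fin 2) (Fin 2) ℂ} (hU : U ∈ Matrix.unitaryGroup (Fin 2) ℂ) (v : H3) :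
    rho1 (act3 U v) = rho1 v := by
  rw [← rho3_sw13, sw13_act3, rho3_act1 hU, rho3_sw13]

lemma rho2_act3 {U : Matrix (Fin 2) (Fin 2) ℂ} (hU : U ∈ Matrix.unitaryGroup (Fin 2) ℂ) (v : H3) :
    rho2 (act3 U v) = rho2 v := by
  rw [← rho2_sw13, sw13_act3, rho2_act1 hU, rho2_sw13]

lemma rho2_act2 (U : Matrix (Fin 2) (Fin 2) ℂ) (v : H3) :
    rho2 (act2 U v) = U * rho2 v * star U := by
  rw [← rho1_sw12, sw12_act2, rho1_act1, rho1_sw12]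

lemma rho3_act3 (U : Matrix (Fin 2) (Fin 2) ℂ) (v : H3) :
    rho3 (act3 U v) = U * rho3 v * star U := by
  rw [← rho1_sw13, sw13_act3, rho1_act1, rho1_sw13]

lemma normSq3_expand (v : H3) : normSq3 v =
    Complex.normSq (v (0,0,0)) + Complex.normSq (v (0,0,1)) + Complex.normSq (v (0,1,0)) +
    Complex.normSq (v (0,1,1)) + Complex.normSq (v (1,0,0)) + Complex.normSq (v (1,0,1)) +
    Complex.normSq (v (1,1,0)) + Complex.normSq (v (1,1,1)) := by
  simp only [normSq3, Fintype.sum_prod_type, Fin.sum_univ_two]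
  ring

lemma mul_star_normSq (z : ℂ) : z * star z = (Complex.normSq z : ℂ) := Complex.mul_conj z

lemma trace_rho1 (v : H3) : (rho1 v).trace = (normSq3 v : ℂ) := by
  rw [normSq3_expand]
  simp only [Matrix.trace, Matrix.diag, rho1, Matrix.of_apply, Fin.sum_univ_two, mul_star_normSq]
  push_cast
  ring

lemma trace_rho2 (v : H3) : (rho2 v).trace = (normSq3 v : ℂ) := by
  rw [normSq3_expand]
  simp only [Matrix.trace, Matrix.diag, rho2, Matrix.of_apply, Fin.sum_univ_two, mul_star_normSq]
  push_cast
  ring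

lemma trace_rho3 (v : H3) : (rho3 v).trace = (normSq3 v : ℂ) := by
  rw [normSq3_expand]
  simp only [Matrix.trace, Matrix.diag, rho3, Matrix.of_apply, Fin.sum_univ_two, mul_star_normSq]
  push_cast
  ring

lemma normSq3_sw12 (v : H3) : normSq3 (sw12 v) = normSq3 v := by
  simp only [normSq3_expand, sw12]; ring

lemma normSq3_sw13 (v : H3) : normSq3 (sw13 v) = normSq3 v := by
  simp only [normSq3_expand, sw13]; ring

lemma minEig_conj {U : Matrix (Fin 2) (Fin 2) ℂ} (hU : U ∈ Matrix.unitaryGroup (Fin 2) ℂ)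
    (M : Matrix (Fin 2) (Fin 2) ℂ) : minEig (U * M * star U) = minEig M := by
  have : spectrum ℂ (U * M * star U) = spectrum ℂ M :=
    Unitary.spectrum_star_right_conjugate (R := ℂ) (a := M) (U := ⟨U, hU⟩)
  simp only [minEig, this]

lemma LU_inv {v w : H3} (h : LUequiv v w) :
    normSq3 w = normSq3 v ∧ p1 w = p1 v ∧ p2 w = p2 v ∧ p3 w = p3 v := by
  obtain ⟨A, B, C, hA, hB, hC, rfl⟩ := h
  rw [tensor3_eq]
  refine ⟨?_, ?_, ?_, ?_⟩
  · have : ((normSq3 (act1 A (act2 B (act3 C v))) : ℝ) : ℂ) = (normSq3 v : ℝ) := by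
      rw [← trace_rho2, rho2_act1 hA, trace_rho2, ← trace_rho1, rho1_act2 hB, rho1_act3 hC,
        trace_rho1]
    exact_mod_cast this
  · rw [p1, p1, rho1_act1, minEig_conj hA, rho1_act2 hB, rho1_act3 hC]
  · rw [p2, p2, rho2_act1 hA, rho2_act2, minEig_conj hB, rho2_act3 hC]
  · rw [p3, p3, rho3_act1 hA, rho3_act2 hB, rho3_act3, minEig_conj hC]

/-! ### Minimal eigenvalue -/

lemma minEig_eq (M : Matrix (Fin 2) (Fin 2) ℂ) (r : ℝ) (s : ℂ) (h00 : M 0 0 = r)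
    (h11 : M 1 1 = ((1 - r : ℝ) : ℂ)) (h01 : M 0 1 = s) (h10 : M 1 0 = star s) :
    minEig M ≤ 1 / 2 ∧ minEig M * (1 - minEig M) = r * (1 - r) - Complex.normSq s := by
  have hs := Complex.normSq_nonneg s
  set D := (1 - 2 * r) ^ 2 + 4 * Complex.normSq s with hD
  have hD0 : 0 ≤ D := by positivity
  have hq := Real.sq_sqrt hD0
  have hq0 := Real.sqrt_nonneg D
  set q := Real.sqrt D
  have hset : {t : ℝ | (t : ℂ) ∈ spectrum ℂ M} = {(1 - q) / 2, (1 + q) / 2} := by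
    ext t
    simp only [Set.mem_ofPred_eq, Set.mem_insert_iff, Set.mem_singleton_iff]
    rw [spectrum.mem_iff, Matrix.isUnit_iff_isUnit_det, isUnit_iff_ne_zero, not_not,
      Matrix.det_fin_two]
    have key : (algebraMap ℂ (Matrix (Fin 2) (Fin 2) ℂ) t - M) 0 0 *
        (algebraMap ℂ (Matrix (Fin 2) (Fin 2) ℂ) t - M) 1 1 -
        (algebraMap ℂ (Matrix (Fin 2) (Fin 2) ℂ) t - M) 0 1 *
        (algebraMap ℂ (Matrix (Fin 2) (Fin 2) ℂ) t - M) 1 0 =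
        (((t - (1 - q) / 2) * (t - (1 + q) / 2) : ℝ) : ℂ) := by
      have e : (t - (1 - q) / 2) * (t - (1 + q) / 2) =
          (t - r) * (t - (1 - r)) - Complex.normSq s := by
        nlinarith
      rw [e]
      simp only [Matrix.sub_apply, Matrix.algebraMap_matrix_apply, h00, h01, h10, h11]
      simp only [if_true, zero_ne_one, one_ne_zero, if_false]
      push_cast
      rw [← mul_star_normSq]
      simp
    rw [key, Complex.ofReal_eq_zero, mul_eq_zero, sub_eq_zero, sub_eq_zero]
  have hmin : minEig M = (1 - q) / 2 := by
    rw [minEig, hset, csInf_pair]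
    exact min_eq_left (by linarith)
  rw [hmin]
  constructor
  · linarith
  · nlinarith

lemma minEig_herm (M : Matrix (Fin 2) (Fin 2) ℂ) (hH : ∀ i j, M j i = star (M i j))
    (ht : M.trace = 1) :
    minEig M ≤ 1 / 2 ∧ minEig M * (1 - minEig M) =
      (M 1 1).re * (1 - (M 1 1).re) - Complex.normSq (M 0 1) := by
  have h0 : M 0 0 = ((M 0 0).re : ℂ) := (Complex.conj_eq_iff_re.1 (hH 0 0).symm).symm
  have h1 : M 1 1 = ((M 1 1).re : ℂ) := (Complex.conj_eq_iff_re.1 (hH 1 1).symm).symm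
  have ht' : (M 0 0).re + (M 1 1).re = 1 := by
    have := congrArg Complex.re ht
    simpa [Matrix.trace, Fin.sum_univ_two] using this
  have h2 : (M 0 0).re = 1 - (M 1 1).re := by linarith
  have h3 : (M 1 1).re = 1 - (M 0 0).re := by linarith
  have := minEig_eq M (M 0 0).re (M 0 1) h0 (by rw [← h3]; exact h1) rfl (hH 0 1)
  refine ⟨this.1, ?_⟩
  rw [this.2, h2]; ring

lemma mkU {x y : ℂ} (h : Complex.normSq x + Complex.normSq y = 1) :
    !![x, y; -star y, star x] ∈ Matrix.unitaryGroup (Fin 2) ℂ := by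
  have h' : x * star x + y * star y = 1 := by
    rw [mul_star_normSq, mul_star_normSq]; exact_mod_cast h
  rw [Matrix.mem_unitaryGroup_iff]
  ext i j
  fin_cases i <;> fin_cases j <;>
    simp [Matrix.mul_apply, Fin.sum_univ_two, Matrix.star_apply] <;>
    first
      | (simp only [Complex.star_def] at h'; linear_combination h')
      | ring

lemma mkX : !![(0 : ℂ), 1; 1, 0] ∈ Matrix.unitaryGroup (Fin 2) ℂ := by
  rw [Matrix.mem_unitaryGroup_iff]
  ext i j
  fin_cases i <;> fin_cases j <;> simp [Matrix.mul_apply, Fin.sum_univ_two, Matrix.star_apply]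

lemma exists_scale (u w : ℂ) (h : u ≠ 0 ∨ w ≠ 0) : ∃ k : ℂ, k ≠ 0 ∧
    Complex.normSq (k * u) + Complex.normSq (k * w) = 1 := by
  have hp : 0 < Complex.normSq u + Complex.normSq w := by
    rcases h with h | h
    · have := Complex.normSq_pos.2 h
      have := Complex.normSq_nonneg w
      linarith
    · have := Complex.normSq_pos.2 h
      have := Complex.normSq_nonneg u
      linarith
  set n := Complex.normSq u + Complex.normSq w
  have hs : 0 < Real.sqrt n := Real.sqrt_pos.2 hp
  refine ⟨((1 / Real.sqrt n : ℝ) : ℂ), ?_, ?_⟩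
  · exact_mod_cast (by positivity : (1 / Real.sqrt n) ≠ 0)
  · rw [map_mul, map_mul, Complex.normSq_ofReal, ← mul_add]
    change _ * n = 1
    have := Real.mul_self_sqrt hp.le
    field_simp
    nlinarith

/-- Unitary diagonalization of a Hermitian form. -/
lemma exists_diag (r q s : ℂ) : ∃ x y : ℂ, Complex.normSq x + Complex.normSq y = 1 ∧
    (q - r) * x * y + s * x ^ 2 - star s * y ^ 2 = 0 := by
  by_cases hs : s = 0
  · exact ⟨1, 0, by simp, by simp [hs]⟩
  · have hs' : star s ≠ 0 := by simpa using hs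
    obtain ⟨d, hd⟩ := IsAlgClosed.exists_pow_nat_eq (discrim (star s) (-(q - r)) (-s))
      (n := 2) (by norm_num)
    obtain ⟨l, hl⟩ := exists_quadratic_eq_zero hs' ⟨d, by rw [← hd]; ring⟩
    obtain ⟨k, -, hk⟩ := exists_scale 1 l (Or.inl one_ne_zero)
    refine ⟨k * 1, k * l, hk, ?_⟩
    linear_combination -(k ^ 2) * hl

lemma exists_ker (u w : ℂ) : ∃ x y : ℂ, Complex.normSq x + Complex.normSq y = 1 ∧
    x * u + y * w = 0 := by
  by_cases h : u ≠ 0 ∨ w ≠ 0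
  · obtain ⟨k, -, hk⟩ := exists_scale w (-u) (by
      rcases h with h | h
      · right; simpa using h
      · left; exact h)
    exact ⟨_, _, hk, by ring⟩
  · push Not at h
    exact ⟨1, 0, by simp, by simp [h.1, h.2]⟩

lemma herm_conj {M : Matrix (Fin 2) (Fin 2) ℂ} (hH : ∀ i j, M j i = star (M i j))
    (U : Matrix (Fin 2) (Fin 2) ℂ) (i j : Fin 2) :
    (U * M * star U) j i = star ((U * M * star U) i j) := by
  have hM : star M = M := by
    ext i j; rw [Matrix.star_apply, ← hH]
  have : star (U * M * star U) = U * M * star U := by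
    rw [star_mul, star_mul, star_star, hM, mul_assoc]
  rw [← Matrix.star_apply, this]

lemma trace_conj {U : Matrix (Fin 2) (Fin 2) ℂ} (hU : U ∈ Matrix.unitaryGroup (Fin 2) ℂ)
    (M : Matrix (Fin 2) (Fin 2) ℂ) : (U * M * star U).trace = M.trace := by
  rw [Matrix.trace_mul_comm, ← mul_assoc, Matrix.mem_unitaryGroup_iff'.1 hU, one_mul]

lemma diagonalize (M : Matrix (Fin 2) (Fin 2) ℂ) (hH : ∀ i j, M j i = star (M i j))
    (ht : M.trace = 1) : ∃ U ∈ Matrix.unitaryGroup (Fin 2) ℂ,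
      ((U * M * star U) 1 1).re = minEig M := by
  obtain ⟨x, y, hxy, h⟩ := exists_diag (M 0 0) (M 1 1) (M 0 1)
  set U := !![x, y; -star y, star x] with hUdef
  have hU : U ∈ Matrix.unitaryGroup (Fin 2) ℂ := mkU hxy
  set N := U * M * star U with hN
  have h01 : N 0 1 = 0 := by
    rw [hN, hUdef]
    simp only [Matrix.mul_apply, Fin.sum_univ_two, Matrix.star_apply]
    simp [hH 0 1]
    simp only [Complex.star_def] at h
    linear_combination h
  have hHN := herm_conj hH U
  have htN : N.trace = 1 := by rw [hN, trace_conj hU, ht]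
  have hm : minEig N = minEig M := minEig_conj hU M
  obtain ⟨e1, e2⟩ := minEig_herm N hHN htN
  rw [h01, hm] at e2
  have e3 : (minEig M - (N 1 1).re) * (minEig M - (1 - (N 1 1).re)) = 0 := by
    simp only [map_zero] at e2
    linarith
  rcases mul_eq_zero.1 e3 with e | e
  · exact ⟨U, hU, by linarith⟩
  · refine ⟨!![(0 : ℂ), 1; 1, 0] * U, mul_mem mkX hU, ?_⟩
    have : (!![(0 : ℂ), 1; 1, 0] * U * M * star (!![(0 : ℂ), 1; 1, 0] * U)) =
        !![(0 : ℂ), 1; 1, 0] * N * star !![(0 : ℂ), 1; 1, 0] := by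
      rw [star_mul, hN]; simp only [mul_assoc]
    rw [this]
    have e0 : (N 0 0).re + (N 1 1).re = 1 := by
      have := congrArg Complex.re htN
      simpa [Matrix.trace, Fin.sum_univ_two] using this
    have e4 : (!![(0 : ℂ), 1; 1, 0] * N * star !![(0 : ℂ), 1; 1, 0]) 1 1 = N 0 0 := by
      simp only [Matrix.mul_apply, Fin.sum_univ_two, Matrix.star_apply]
      simp
    rw [e4]; linarith

lemma rho1_herm (v : H3) (i j : Fin 2) : rho1 v j i = star (rho1 v i j) := by
  simp [rho1, mul_comm]
lemma rho2_herm (v : H3) (i j : Fin 2) : rho2 v j i = star (rho2 v i j) := by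
  simp [rho2, mul_comm]
lemma rho3_herm (v : H3) (i j : Fin 2) : rho3 v j i = star (rho3 v i j) := by
  simp [rho3, mul_comm]

lemma rho1_11 (v : H3) : (rho1 v 1 1).re = Complex.normSq (v (1,0,0)) +
    Complex.normSq (v (1,0,1)) + Complex.normSq (v (1,1,0)) + Complex.normSq (v (1,1,1)) := by
  simp only [rho1, Matrix.of_apply, Fin.sum_univ_two, mul_star_normSq, Complex.add_re,
    Complex.ofReal_re]
  ring
lemma rho2_11 (v : H3) : (rho2 v 1 1).re = Complex.normSq (v (0,1,0)) +
    Complex.normSq (v (0,1,1)) + Complex.normSq (v (1,1,0)) + Complex.normSq (v (1,1,1)) := by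
  simp only [rho2, Matrix.of_apply, Fin.sum_univ_two, mul_star_normSq, Complex.add_re,
    Complex.ofReal_re]
  ring
lemma rho3_11 (v : H3) : (rho3 v 1 1).re = Complex.normSq (v (0,0,1)) +
    Complex.normSq (v (0,1,1)) + Complex.normSq (v (1,0,1)) + Complex.normSq (v (1,1,1)) := by
  simp only [rho3, Matrix.of_apply, Fin.sum_univ_two, mul_star_normSq, Complex.add_re,
    Complex.ofReal_re]
  ring

lemma dens1 {v : H3} (hv : normSq3 v = 1) : p1 v ≤ 1 / 2 ∧ p1 v * (1 - p1 v) =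
    (rho1 v 1 1).re * (1 - (rho1 v 1 1).re) - Complex.normSq (rho1 v 0 1) :=
  minEig_herm _ (rho1_herm v) (by rw [trace_rho1, hv]; simp)
lemma dens2 {v : H3} (hv : normSq3 v = 1) : p2 v ≤ 1 / 2 ∧ p2 v * (1 - p2 v) =
    (rho2 v 1 1).re * (1 - (rho2 v 1 1).re) - Complex.normSq (rho2 v 0 1) :=
  minEig_herm _ (rho2_herm v) (by rw [trace_rho2, hv]; simp)
lemma dens3 {v : H3} (hv : normSq3 v = 1) : p3 v ≤ 1 / 2 ∧ p3 v * (1 - p3 v) =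
    (rho3 v 1 1).re * (1 - (rho3 v 1 1).re) - Complex.normSq (rho3 v 0 1) :=
  minEig_herm _ (rho3_herm v) (by rw [trace_rho3, hv]; simp)

lemma p1_le {v : H3} (hv : normSq3 v = 1) : p1 v ≤ (rho1 v 1 1).re := by
  obtain ⟨h1, h2⟩ := dens1 hv
  have := Complex.normSq_nonneg (rho1 v 0 1)
  nlinarith

/-- Support on even-parity basis vectors. -/
def IsEven (u : H3) : Prop :=
  u (0,0,1) = 0 ∧ u (0,1,0) = 0 ∧ u (1,0,0) = 0 ∧ u (1,1,1) = 0

/-- The state `v` has a canonical even-parity form, dictated by its local spectra. -/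
def Canon (v : H3) : Prop := ∃ u : H3, LUequiv v u ∧ IsEven u ∧
  Complex.normSq (u (0,0,0)) = 1 - (p1 v + p2 v + p3 v) / 2 ∧
  Complex.normSq (u (0,1,1)) = (p2 v + p3 v - p1 v) / 2 ∧
  Complex.normSq (u (1,0,1)) = (p1 v + p3 v - p2 v) / 2 ∧
  Complex.normSq (u (1,1,0)) = (p1 v + p2 v - p3 v) / 2

lemma p1_sw12 (v : H3) : p1 (sw12 v) = p2 v := rfl
lemma p2_sw12 (v : H3) : p2 (sw12 v) = p1 v := rfl
lemma p3_sw12 (v : H3) : p3 (sw12 v) = p3 v := by rw [p3, rho3_sw12, p3]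
lemma p1_sw13 (v : H3) : p1 (sw13 v) = p3 v := by rw [p1, rho1_sw13, p3]
lemma p2_sw13 (v : H3) : p2 (sw13 v) = p2 v := by rw [p2, rho2_sw13, p2]
lemma p3_sw13 (v : H3) : p3 (sw13 v) = p1 v := by rw [p3, rho3_sw13, p1]

lemma sw12_apply (u : H3) (a b c : Fin 2) : sw12 u (a, b, c) = u (b, a, c) := rfl

lemma canon_sw12 {v : H3} (h : Canon (sw12 v)) : Canon v := by
  obtain ⟨u, hu, he, h1, h2, h3, h4⟩ := h
  rw [p1_sw12, p2_sw12, p3_sw12] at h1 h2 h3 h4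
  have hu' := LU_sw12 hu
  rw [sw12_sw12] at hu'
  refine ⟨sw12 u, hu', ?_, ?_, ?_, ?_, ?_⟩
  · obtain ⟨e1, e2, e3, e4⟩ := he
    unfold IsEven
    simp only [sw12_apply]
    exact ⟨e1, e3, e2, e4⟩
  · rw [sw12_apply]; exact h1.trans (by ring)
  · rw [sw12_apply]; exact h3.trans (by ring)
  · rw [sw12_apply]; exact h2.trans (by ring)
  · rw [sw12_apply]; exact h4.trans (by ring)

lemma sw13_apply (u : H3) (a b c : Fin 2) : sw13 u (a, b, c) = u (c, b, a) := rfl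

lemma canon_sw13 {v : H3} (h : Canon (sw13 v)) : Canon v := by
  obtain ⟨u, hu, he, h1, h2, h3, h4⟩ := h
  rw [p1_sw13, p2_sw13, p3_sw13] at h1 h2 h3 h4
  have hu' := LU_sw13 hu
  rw [sw13_sw13] at hu'
  refine ⟨sw13 u, hu', ?_, ?_, ?_, ?_, ?_⟩
  · obtain ⟨e1, e2, e3, e4⟩ := he
    unfold IsEven
    simp only [sw13_apply]
    exact ⟨e3, e2, e1, e4⟩
  · rw [sw13_apply]; exact h1.trans (by ring)
  · rw [sw13_apply]; exact h4.trans (by ring)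
  · rw [sw13_apply]; exact h3.trans (by ring)
  · rw [sw13_apply]; exact h2.trans (by ring)

/-- The polygonal inequality, together with the equality case. -/
lemma facet {v : H3} (hv : normSq3 v = 1) :
    p1 v ≤ p2 v + p3 v ∧ (p1 v = p2 v + p3 v → Canon v) := by
  obtain ⟨U2, hU2, h2⟩ := diagonalize (rho2 v) (rho2_herm v) (by rw [trace_rho2, hv]; simp)
  obtain ⟨U3, hU3, h3⟩ := diagonalize (rho3 v) (rho3_herm v) (by rw [trace_rho3, hv]; simp)
  set v' := act2 U2 (act3 U3 v) with hv'
  obtain ⟨x, y, hxy, h1⟩ := exists_ker (v' (1,0,0)) (-v' (0,0,0))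
  have hU1 : !![star x, -star (-y); -y, x] ∈ Matrix.unitaryGroup (Fin 2) ℂ := by
    have := @mkU (star x) (star y) (by simpa using hxy)
    simpa using this
  set U1 := !![star x, -star (-y); -y, x] with hU1d
  set u := act1 U1 v' with hu
  have hLU : LUequiv v u :=
    ((LU_act3 hU3 v).trans (LU_act2 hU2 _)).trans (LU_act1 hU1 _)
  obtain ⟨i0, i1, i2, i3⟩ := LU_inv hLU
  have hun : normSq3 u = 1 := by rw [i0, hv]
  have u100 : u (1,0,0) = 0 := by
    simp [hu, act1, hU1d]
    linear_combination h1
  have r2 : (rho2 u 1 1).re = p2 v := by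
    rw [hu, rho2_act1 hU1, hv', rho2_act2, rho2_act3 hU3, h2, p2]
  have r3 : (rho3 u 1 1).re = p3 v := by
    rw [hu, rho3_act1 hU1, hv', rho3_act2 hU2, rho3_act3, h3, p3]
  have r1 := p1_le hun
  rw [i1, rho1_11] at r1
  rw [rho2_11] at r2
  rw [rho3_11] at r3
  rw [normSq3_expand] at hun
  rw [u100, Complex.normSq_zero] at r1 hun
  have n1 := Complex.normSq_nonneg (u (0,0,1))
  have n2 := Complex.normSq_nonneg (u (0,1,0))
  have n3 := Complex.normSq_nonneg (u (0,1,1))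
  have n4 := Complex.normSq_nonneg (u (1,1,1))
  refine ⟨by linarith, fun he => ⟨u, hLU, ⟨?_, ?_, u100, ?_⟩, ?_, ?_, ?_, ?_⟩⟩
  · exact Complex.normSq_eq_zero.1 (by linarith)
  · exact Complex.normSq_eq_zero.1 (by linarith)
  · exact Complex.normSq_eq_zero.1 (by linarith)
  · linarith
  · linarith
  · linarith
  · linarith

lemma H3_ext {v w : H3} (h000 : v (0,0,0) = w (0,0,0)) (h001 : v (0,0,1) = w (0,0,1))
    (h010 : v (0,1,0) = w (0,1,0)) (h011 : v (0,1,1) = w (0,1,1))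
    (h100 : v (1,0,0) = w (1,0,0)) (h101 : v (1,0,1) = w (1,0,1))
    (h110 : v (1,1,0) = w (1,1,0)) (h111 : v (1,1,1) = w (1,1,1)) : v = w := by
  have : ∀ a b c : Fin 2, v (a, b, c) = w (a, b, c) := by
    simp only [Fin.forall_fin_two]
    exact ⟨⟨⟨h000, h001⟩, h010, h011⟩, ⟨h100, h101⟩, h110, h111⟩
  ext ⟨a, b, c⟩
  exact this a b c

lemma exists_phase {z z' : ℂ} (h : Complex.normSq z' = Complex.normSq z) :
    ∃ t : ℝ, z' = Complex.exp (t * Complex.I) * z := by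
  have hn : ‖z'‖ = ‖z‖ := by
    rw [Complex.normSq_eq_norm_sq, Complex.normSq_eq_norm_sq] at h
    exact (sq_eq_sq₀ (norm_nonneg _) (norm_nonneg _)).1 h
  refine ⟨z'.arg - z.arg, ?_⟩
  have e1 := Complex.norm_mul_exp_arg_mul_I z
  have e2 := Complex.norm_mul_exp_arg_mul_I z'
  have e3 : Complex.exp (((z'.arg - z.arg : ℝ) : ℂ) * Complex.I) *
      Complex.exp (z.arg * Complex.I) = Complex.exp (z'.arg * Complex.I) := by
    rw [← Complex.exp_add]; congr 1; push_cast; ring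
  rw [hn] at e2
  linear_combination -e2 +
    Complex.exp (((z'.arg - z.arg : ℝ) : ℂ) * Complex.I) * e1 - (‖z‖ : ℂ) * e3

lemma normSq_exp (t : ℝ) : Complex.normSq (Complex.exp (t * Complex.I)) = 1 := by
  rw [Complex.normSq_eq_norm_sq, Complex.norm_exp_ofReal_mul_I]; norm_num

lemma mkD {x y : ℂ} (hx : Complex.normSq x = 1) (hy : Complex.normSq y = 1) :
    !![x, 0; 0, y] ∈ Matrix.unitaryGroup (Fin 2) ℂ := by
  have hx' : x * star x = 1 := by rw [mul_star_normSq, hx]; simp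
  have hy' : y * star y = 1 := by rw [mul_star_normSq, hy]; simp
  rw [Matrix.mem_unitaryGroup_iff]
  ext i j
  simp only [Complex.star_def] at hx' hy'
  fin_cases i <;> fin_cases j <;>
    simp [Matrix.mul_apply, Fin.sum_univ_two, Matrix.star_apply, hx', hy']

/-- Even states are determined up to LU by the moduli of their coordinates. -/
lemma even_equiv {u w : H3} (hu : IsEven u) (hw : IsEven w)
    (h0 : Complex.normSq (w (0,0,0)) = Complex.normSq (u (0,0,0)))
    (h1 : Complex.normSq (w (0,1,1)) = Complex.normSq (u (0,1,1)))
    (h2 : Complex.normSq (w (1,0,1)) = Complex.normSq (u (1,0,1)))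
    (h3 : Complex.normSq (w (1,1,0)) = Complex.normSq (u (1,1,0))) : LUequiv u w := by
  obtain ⟨a, ha⟩ := exists_phase h0
  obtain ⟨b, hb⟩ := exists_phase h1
  obtain ⟨c, hc⟩ := exists_phase h2
  obtain ⟨d, hd⟩ := exists_phase h3
  obtain ⟨u1, u2, u3, u4⟩ := hu
  obtain ⟨w1, w2, w3, w4⟩ := hw
  set S : ℝ := (b - a + c + d) / 2 with hS
  set X : ℝ := S - (b - a) with hX
  set Y : ℝ := S - c with hY
  set Z : ℝ := S - d with hZ
  have n1 : Complex.normSq 1 = 1 := by simp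
  refine ⟨_, _, _, mkD (normSq_exp a) (normSq_exp X), mkD n1 (normSq_exp Y),
    mkD n1 (normSq_exp Z), ?_⟩
  have eb : Complex.exp (b * Complex.I) = Complex.exp (a * Complex.I) *
      (Complex.exp (Y * Complex.I) * Complex.exp (Z * Complex.I)) := by
    rw [← Complex.exp_add, ← Complex.exp_add]; congr 1
    rw [hY, hZ, hS]; push_cast; ring
  have ec : Complex.exp (c * Complex.I) = Complex.exp (X * Complex.I) *
      Complex.exp (Z * Complex.I) := by
    rw [← Complex.exp_add]; congr 1
    rw [hX, hZ, hS]; push_cast; ring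
  have ed : Complex.exp (d * Complex.I) = Complex.exp (X * Complex.I) *
      Complex.exp (Y * Complex.I) := by
    rw [← Complex.exp_add]; congr 1
    rw [hX, hY, hS]; push_cast; ring
  rw [eb] at hb
  rw [ec] at hc
  rw [ed] at hd
  rw [tensor3_eq]
  apply H3_ext <;> simp only [act1, act2, act3, Matrix.of_apply, Matrix.cons_val',
    Matrix.cons_val_zero, Matrix.cons_val_one, Matrix.cons_val_fin_one] <;>
    simp only [u1, u2, u3, u4, w1, w2, w3, w4, ha, hb, hc, hd] <;> ring

lemma half_rho {v : H3} (hv : normSq3 v = 1) (h : p1 v = 1 / 2) :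
    (rho1 v 1 1).re = 1 / 2 ∧ rho1 v 0 1 = 0 := by
  have h2 := (dens1 hv).2
  rw [h] at h2
  have n := Complex.normSq_nonneg (rho1 v 0 1)
  have : (rho1 v 1 1).re = 1 / 2 := by
    have : ((rho1 v 1 1).re - 1 / 2) ^ 2 ≤ 0 := by nlinarith
    have := pow_eq_zero_iff (two_ne_zero) |>.1 (le_antisymm this (sq_nonneg _))
    linarith
  refine ⟨this, Complex.normSq_eq_zero.1 ?_⟩
  rw [this] at h2
  linarith

lemma exists_hopf (P Q R : ℂ) : ∃ x y : ℂ, Complex.normSq x + Complex.normSq y = 1 ∧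
    P * (star x * y) + Q * (x * star y) + R * (x * star x - y * star y) = 0 := by
  -- a nonzero vector in the kernel of a real-linear map from dimension 3 to dimension 2
  have hker : LinearMap.ker (Fintype.linearCombination ℝ ![P + Q, (P - Q) * Complex.I, R]) ≠ ⊥ :=
    LinearMap.ker_ne_bot_of_finrank_lt (by simp [Complex.finrank_real_complex])
  obtain ⟨f, hf, hf0⟩ := (Submodule.ne_bot_iff _).1 hker
  rw [LinearMap.mem_ker, Fintype.linearCombination_apply, Fin.sum_univ_three] at hf
  simp only [Matrix.cons_val_zero, Matrix.cons_val_one, Matrix.cons_val, Complex.real_smul] at hf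
  have hpos : 0 < 4 * (f 0 ^ 2 + f 1 ^ 2) + f 2 ^ 2 := by
    by_contra hcon
    apply hf0
    have h0 : f 0 = 0 := by nlinarith [sq_nonneg (f 0), sq_nonneg (f 1), sq_nonneg (f 2)]
    have h1 : f 1 = 0 := by nlinarith [sq_nonneg (f 0), sq_nonneg (f 1), sq_nonneg (f 2)]
    have h2 : f 2 = 0 := by nlinarith [sq_nonneg (f 0), sq_nonneg (f 1), sq_nonneg (f 2)]
    ext i
    fin_cases i <;> simp [h0, h1, h2]
  set N := 4 * (f 0 ^ 2 + f 1 ^ 2) + f 2 ^ 2 with hN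
  have hs := Real.sqrt_pos.2 hpos
  have hss := Real.sq_sqrt hpos.le
  set n := Real.sqrt N
  -- normalized
  obtain ⟨a, b, h, hone, hlin⟩ : ∃ a b h : ℝ, 4 * (a ^ 2 + b ^ 2) + h ^ 2 = 1 ∧
      (a : ℂ) * (P + Q) + b * ((P - Q) * Complex.I) + h * R = 0 := by
    refine ⟨f 0 / n, f 1 / n, f 2 / n, ?_, ?_⟩
    · field_simp
      linarith
    · have hn : (n : ℂ) ≠ 0 := by exact_mod_cast hs.ne'
      push_cast
      field_simp
      linear_combination hf
  by_cases hh : 1 + h = 0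
  · have hh' : h = -1 := by linarith
    have ha : a = 0 := by nlinarith [sq_nonneg a, sq_nonneg b]
    have hb : b = 0 := by nlinarith [sq_nonneg a, sq_nonneg b]
    refine ⟨0, 1, by simp, ?_⟩
    rw [ha, hb, hh'] at hlin
    simp at hlin ⊢
    exact hlin
  · have hp : 0 < 1 + h := by
      have : -1 ≤ h := by nlinarith [sq_nonneg a, sq_nonneg b]
      exact lt_of_le_of_ne (by linarith) (Ne.symm hh)
    have hp2 : 0 < (1 + h) / 2 := by linarith
    have ht := Real.sqrt_pos.2 hp2
    have htt := Real.sq_sqrt hp2.le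
    set t := Real.sqrt ((1 + h) / 2)
    have htC : (t : ℂ) ≠ 0 := by exact_mod_cast ht.ne'
    have hyy : (a / t) ^ 2 + (b / t) ^ 2 = (1 - h) / 2 := by
      rw [div_pow, div_pow, htt]
      field_simp
      nlinarith
    refine ⟨t, ((a / t : ℝ) : ℂ) + ((b / t : ℝ) : ℂ) * Complex.I, ?_, ?_⟩
    · rw [Complex.normSq_add_mul_I, hyy, Complex.normSq_ofReal]
      nlinarith
    · have e1 : star (t : ℂ) = t := Complex.conj_ofReal t
      have e2 : star (((a / t : ℝ) : ℂ) + ((b / t : ℝ) : ℂ) * Complex.I) =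
          ((a / t : ℝ) : ℂ) - ((b / t : ℝ) : ℂ) * Complex.I := by
        simp [sub_eq_add_neg]
      have e3 : (t : ℂ) * star (t : ℂ) - (((a / t : ℝ) : ℂ) + ((b / t : ℝ) : ℂ) * Complex.I) *
          star (((a / t : ℝ) : ℂ) + ((b / t : ℝ) : ℂ) * Complex.I) = h := by
        rw [mul_star_normSq, mul_star_normSq, Complex.normSq_add_mul_I, hyy, Complex.normSq_ofReal,
          ← sq, htt]
        push_cast; ring
      rw [e3, e1, e2]
      have e4 : (t : ℂ) * ((a / t : ℝ) : ℂ) = a := by push_cast; field_simp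
      have e5 : (t : ℂ) * ((b / t : ℝ) : ℂ) = b := by push_cast; field_simp
      linear_combination hlin + (P + Q) * e4 + (P - Q) * Complex.I * e5

/-- Polarized determinant of the two slices (with respect to the first qubit). -/
noncomputable def pol (v : H3) : ℂ :=
  v (0,0,0) * v (1,1,1) + v (1,0,0) * v (0,1,1) - v (0,0,1) * v (1,1,0) - v (1,0,1) * v (0,1,0)

lemma pol_act2 (U : Matrix (Fin 2) (Fin 2) ℂ) (v : H3) : pol (act2 U v) = U.det * pol v := by
  rw [Matrix.det_fin_two]
  simp only [pol, act2]
  ring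

lemma pol_act3 (U : Matrix (Fin 2) (Fin 2) ℂ) (v : H3) : pol (act3 U v) = U.det * pol v := by
  rw [Matrix.det_fin_two]
  simp only [pol, act3]
  ring

lemma act1_mk0 (x y z w : ℂ) (v : H3) (b c : Fin 2) :
    act1 !![x, y; z, w] v (0, b, c) = x * v (0, b, c) + y * v (1, b, c) := by
  simp [act1]
lemma act1_mk1 (x y z w : ℂ) (v : H3) (b c : Fin 2) :
    act1 !![x, y; z, w] v (1, b, c) = z * v (0, b, c) + w * v (1, b, c) := by
  simp [act1]
lemma act2_mk0 (x y z w : ℂ) (v : H3) (a c : Fin 2) :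
    act2 !![x, y; z, w] v (a, 0, c) = x * v (a, 0, c) + y * v (a, 1, c) := by
  simp [act2]
lemma act2_mk1 (x y z w : ℂ) (v : H3) (a c : Fin 2) :
    act2 !![x, y; z, w] v (a, 1, c) = z * v (a, 0, c) + w * v (a, 1, c) := by
  simp [act2]
lemma act3_mk0 (x y z w : ℂ) (v : H3) (a b : Fin 2) :
    act3 !![x, y; z, w] v (a, b, 0) = x * v (a, b, 0) + y * v (a, b, 1) := by
  simp [act3]
lemma act3_mk1 (x y z w : ℂ) (v : H3) (a b : Fin 2) :
    act3 !![x, y; z, w] v (a, b, 1) = z * v (a, b, 0) + w * v (a, b, 1) := by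
  simp [act3]

/-- Takagi-type step. -/
lemma half_step1 (v : H3) : ∃ u, LUequiv v u ∧ pol u = 0 := by
  obtain ⟨x, y, hxy, h⟩ := exists_hopf
    (2 * (v (1,0,0) * v (1,1,1) - v (1,0,1) * v (1,1,0)))
    (-(2 * (v (0,0,0) * v (0,1,1) - v (0,0,1) * v (0,1,0)))) (pol v)
  refine ⟨_, LU_act1 (mkU hxy) v, ?_⟩
  simp only [pol, act1_mk0, act1_mk1] at h ⊢
  linear_combination h

/-- Singular value decomposition of the first slice. -/
lemma half_step2 (v : H3) (h : pol v = 0) :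
    ∃ u, LUequiv v u ∧ pol u = 0 ∧ u (0,0,1) = 0 ∧ u (0,1,0) = 0 := by
  obtain ⟨x, y, hxy, h1⟩ := exists_diag
    (v (0,0,0) * star (v (0,0,0)) + v (0,1,0) * star (v (0,1,0)))
    (v (0,0,1) * star (v (0,0,1)) + v (0,1,1) * star (v (0,1,1)))
    (v (0,0,0) * star (v (0,0,1)) + v (0,1,0) * star (v (0,1,1)))
  set v' := act3 !![x, y; -star y, star x] v with hv'
  have hL : LUequiv v v' := LU_act3 (mkU hxy) v
  have hp : pol v' = 0 := by rw [hv', pol_act3, h, mul_zero]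
  have ho : v' (0,0,0) * star (v' (0,0,1)) + v' (0,1,0) * star (v' (0,1,1)) = 0 := by
    simp only [hv', act3_mk0, act3_mk1, star_add, star_mul', star_neg, star_star] at h1 ⊢
    linear_combination h1
  clear_value v'
  by_cases hc : v' (0,0,1) = 0 ∧ v' (0,1,1) = 0
  · obtain ⟨x, y, hxy, h2⟩ := exists_ker (v' (0,1,0)) (-v' (0,0,0))
    have hU : !![star x, star y; -y, x] ∈ Matrix.unitaryGroup (Fin 2) ℂ := by
      have := @mkU (star x) (star y) (by simpa using hxy)
      simpa using this
    refine ⟨_, hL.trans (LU_act2 hU v'), by rw [pol_act2, hp, mul_zero], ?_, ?_⟩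
    · rw [act2_mk0, hc.1, hc.2]; ring
    · rw [act2_mk1]; linear_combination h2
  · obtain ⟨k, hk, hn⟩ := exists_scale (v' (0,1,1)) (-v' (0,0,1)) (by
      by_contra hcon
      push Not at hcon
      exact hc ⟨by simpa using hcon.2, hcon.1⟩)
    refine ⟨_, hL.trans (LU_act2 (mkU hn) v'), by rw [pol_act2, hp, mul_zero], ?_, ?_⟩
    · rw [act2_mk0]; ring
    · rw [act2_mk1]; simp only [star_mul', star_neg]
      linear_combination star k * ho

lemma half_even {v : H3} (hv : normSq3 v = 1) (h : p1 v = 1 / 2) :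
    ∃ u, LUequiv v u ∧ IsEven u := by
  obtain ⟨u1, hu1, e1⟩ := half_step1 v
  obtain ⟨u, hu2, e2, z1, z2⟩ := half_step2 u1 e1
  have hL := hu1.trans hu2
  obtain ⟨i0, i1, -, -⟩ := LU_inv hL
  rw [hv] at i0
  rw [h] at i1
  obtain ⟨r1, r2⟩ := half_rho i0 i1
  have o1 : u (0,0,0) * star (u (1,0,0)) + u (0,1,1) * star (u (1,1,1)) = 0 := by
    simp only [rho1, Matrix.of_apply, Fin.sum_univ_two, z1, z2, zero_mul] at r2
    linear_combination r2
  have o2 : u (0,0,0) * u (1,1,1) + u (1,0,0) * u (0,1,1) = 0 := by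
    simp only [pol, z1, z2] at e2
    linear_combination e2
  have o1' : star (u (0,0,0)) * u (1,0,0) + star (u (0,1,1)) * u (1,1,1) = 0 := by
    have := congrArg star o1
    simpa using this
  have nrm : Complex.normSq (u (0,0,0)) + Complex.normSq (u (0,1,1)) = 1 / 2 := by
    rw [rho1_11] at r1
    rw [normSq3_expand, z1, z2] at i0
    simp only [Complex.normSq_zero] at i0
    linarith
  by_cases hab : Complex.normSq (u (0,0,0)) = Complex.normSq (u (0,1,1))
  · -- degenerate case
    obtain ⟨t, ht⟩ := exists_phase hab
    have n1 : Complex.normSq 1 = 1 := by simp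
    have hD := mkD n1 (normSq_exp t)
    set w := act3 !![1, 0; 0, Complex.exp (t * Complex.I)] u with hw
    have hLw : LUequiv v w := hL.trans (LU_act3 hD u)
    have w1 : w (0,0,1) = 0 := by rw [hw, act3_mk1, z1]; ring
    have w2 : w (0,1,0) = 0 := by rw [hw, act3_mk0, z2]; ring
    have w3 : w (0,1,1) = w (0,0,0) := by
      rw [hw, act3_mk1, act3_mk0, ht]; ring
    have w4 : w (1,0,0) + w (1,1,1) = 0 := by
      have hne : w (0,0,0) ≠ 0 := by
        intro h0
        have : u (0,0,0) = 0 := by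
          rw [hw, act3_mk0] at h0
          linear_combination h0
        rw [← hab, this] at nrm
        norm_num at nrm
      have hp : pol w = 0 := by rw [hw, pol_act3, e2, mul_zero]
      rw [pol, w1, w2, w3] at hp
      apply mul_left_cancel₀ hne
      linear_combination hp
    clear_value w
    obtain ⟨x, y, hxy, hh⟩ := exists_hopf (w (1,1,0)) (w (1,0,1)) (w (1,0,0))
    have hU : !![star x, star y; -y, x] ∈ Matrix.unitaryGroup (Fin 2) ℂ := by
      have := @mkU (star x) (star y) (by simpa using hxy)
      simpa using this
    refine ⟨_, (hLw.trans (LU_act2 (mkU hxy) w)).trans (LU_act3 hU _), ?_, ?_, ?_, ?_⟩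
    · simp only [act3_mk1, act3_mk0, act2_mk0, act2_mk1, w1, w2, w3]; ring
    · simp only [act3_mk1, act3_mk0, act2_mk0, act2_mk1, w1, w2, w3]; ring
    · simp only [act3_mk1, act3_mk0, act2_mk0, act2_mk1]
      linear_combination hh + y * star y * w4
    · simp only [act3_mk1, act3_mk0, act2_mk0, act2_mk1]
      linear_combination -hh + x * star x * w4
  · have hd : ((Complex.normSq (u (0,0,0)) - Complex.normSq (u (0,1,1)) : ℝ) : ℂ) ≠ 0 := by
      exact_mod_cast sub_ne_zero.2 hab
    push_cast at hd
    rw [← mul_star_normSq, ← mul_star_normSq] at hd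
    refine ⟨u, hL, z1, z2, ?_, ?_⟩
    · apply mul_left_cancel₀ hd
      linear_combination u (0,0,0) * o1' - star (u (0,1,1)) * o2
    · apply mul_left_cancel₀ hd
      linear_combination star (u (0,0,0)) * o2 - u (0,1,1) * o1'

lemma even_rho2_11 {u : H3} (hu : IsEven u) :
    (rho2 u 1 1).re = Complex.normSq (u (0,1,1)) + Complex.normSq (u (1,1,0)) := by
  obtain ⟨u1, u2, u3, u4⟩ := hu
  rw [rho2_11, u2, u4]; simp
lemma even_rho3_11 {u : H3} (hu : IsEven u) :
    (rho3 u 1 1).re = Complex.normSq (u (0,1,1)) + Complex.normSq (u (1,0,1)) := by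
  obtain ⟨u1, u2, u3, u4⟩ := hu
  rw [rho3_11, u1, u4]; simp
lemma even_rho1_11 {u : H3} (hu : IsEven u) :
    (rho1 u 1 1).re = Complex.normSq (u (1,0,1)) + Complex.normSq (u (1,1,0)) := by
  obtain ⟨u1, u2, u3, u4⟩ := hu
  rw [rho1_11, u3, u4]; simp

lemma even_off {u : H3} (hu : IsEven u) : rho2 u 0 1 = 0 ∧ rho3 u 0 1 = 0 := by
  obtain ⟨u1, u2, u3, u4⟩ := hu
  simp [rho2, rho3, Fin.sum_univ_two, u1, u2, u3, u4]

lemma flip2 {u : H3} (hu : IsEven u) : ∃ w, LUequiv u w ∧ IsEven w ∧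
    w (0,0,0) = u (1,1,0) ∧ w (0,1,1) = u (1,0,1) ∧ w (1,0,1) = u (0,1,1) ∧
    w (1,1,0) = u (0,0,0) := by
  obtain ⟨u1, u2, u3, u4⟩ := hu
  refine ⟨_, (LU_act1 mkX u).trans (LU_act2 mkX _), ⟨?_, ?_, ?_, ?_⟩, ?_, ?_, ?_, ?_⟩ <;>
    simp [act1_mk0, act1_mk1, act2_mk0, act2_mk1, u1, u2, u3, u4]

lemma flip3 {u : H3} (hu : IsEven u) : ∃ w, LUequiv u w ∧ IsEven w ∧
    w (0,0,0) = u (1,0,1) ∧ w (0,1,1) = u (1,1,0) ∧ w (1,0,1) = u (0,0,0) ∧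
    w (1,1,0) = u (0,1,1) := by
  obtain ⟨u1, u2, u3, u4⟩ := hu
  refine ⟨_, (LU_act1 mkX u).trans (LU_act3 mkX _), ⟨?_, ?_, ?_, ?_⟩, ?_, ?_, ?_, ?_⟩ <;>
    simp [act1_mk0, act1_mk1, act3_mk0, act3_mk1, u1, u2, u3, u4]

lemma half_canon {v : H3} (hv : normSq3 v = 1) (h : p1 v = 1 / 2) : Canon v := by
  obtain ⟨u, hL, hu⟩ := half_even hv h
  -- flip the second qubit if needed
  obtain ⟨u', hL', hu', hb'⟩ : ∃ w, LUequiv v w ∧ IsEven w ∧ (rho2 w 1 1).re ≤ 1 / 2 := by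
    by_cases hc : (rho2 u 1 1).re ≤ 1 / 2
    · exact ⟨u, hL, hu, hc⟩
    · obtain ⟨w, hw, he, f0, f1, f2, f3⟩ := flip2 hu
      refine ⟨w, hL.trans hw, he, ?_⟩
      have hn := (LU_inv hL).1
      rw [hv, normSq3_expand] at hn
      rw [even_rho2_11 hu] at hc
      obtain ⟨u1, u2, u3, u4⟩ := hu
      simp only [u1, u2, u3, u4, map_zero] at hn
      rw [even_rho2_11 he, f1, f3]
      linarith
  obtain ⟨w, hLw, hw, hb, hb3⟩ : ∃ w, LUequiv v w ∧ IsEven w ∧ (rho2 w 1 1).re ≤ 1 / 2 ∧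
      (rho3 w 1 1).re ≤ 1 / 2 := by
    by_cases hc : (rho3 u' 1 1).re ≤ 1 / 2
    · exact ⟨u', hL', hu', hb', hc⟩
    · obtain ⟨w, hw, he, f0, f1, f2, f3⟩ := flip3 hu'
      refine ⟨w, hL'.trans hw, he, ?_, ?_⟩
      · rw [even_rho2_11 hu'] at hb'
        rw [even_rho2_11 he, f1, f3]
        linarith
      · have hn := (LU_inv hL').1
        rw [hv, normSq3_expand] at hn
        rw [even_rho3_11 hu'] at hc
        obtain ⟨u1, u2, u3, u4⟩ := hu'
        simp only [u1, u2, u3, u4, map_zero] at hn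
        rw [even_rho3_11 he, f1, f2]
        linarith
  obtain ⟨i0, i1, i2, i3⟩ := LU_inv hLw
  rw [hv] at i0
  obtain ⟨q1, -⟩ := half_rho i0 (i1.trans h)
  obtain ⟨d2, d2'⟩ := dens2 i0
  obtain ⟨d3, d3'⟩ := dens3 i0
  rw [i2, (even_off hw).1, map_zero] at d2'
  rw [i3, (even_off hw).2, map_zero] at d3'
  rw [i2] at d2
  rw [i3] at d3
  have q2 : (rho2 w 1 1).re = p2 v := by nlinarith
  have q3 : (rho3 w 1 1).re = p3 v := by nlinarith
  rw [even_rho1_11 hw] at q1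
  rw [even_rho2_11 hw] at q2
  rw [even_rho3_11 hw] at q3
  rw [normSq3_expand] at i0
  have hw' := hw
  obtain ⟨u1, u2, u3, u4⟩ := hw'
  simp only [u1, u2, u3, u4, map_zero] at i0
  exact ⟨w, hLw, hw, by linarith, by linarith, by linarith, by linarith⟩

/-- The Cayley hyperdeterminant. -/
noncomputable def hdet (v : H3) : ℂ :=
  v (0,0,0) ^ 2 * v (1,1,1) ^ 2 + v (0,0,1) ^ 2 * v (1,1,0) ^ 2 +
  v (0,1,0) ^ 2 * v (1,0,1) ^ 2 + v (1,0,0) ^ 2 * v (0,1,1) ^ 2 -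
  2 * (v (0,0,0) * v (0,0,1) * v (1,1,0) * v (1,1,1) +
    v (0,0,0) * v (0,1,0) * v (1,0,1) * v (1,1,1) +
    v (0,0,0) * v (1,0,0) * v (0,1,1) * v (1,1,1) +
    v (0,0,1) * v (0,1,0) * v (1,0,1) * v (1,1,0) +
    v (0,0,1) * v (1,0,0) * v (0,1,1) * v (1,1,0) +
    v (0,1,0) * v (1,0,0) * v (0,1,1) * v (1,0,1)) +
  4 * (v (0,0,0) * v (0,1,1) * v (1,0,1) * v (1,1,0) +
    v (0,0,1) * v (0,1,0) * v (1,0,0) * v (1,1,1))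

lemma hdet_act1 (U : Matrix (Fin 2) (Fin 2) ℂ) (v : H3) :
    hdet (act1 U v) = U.det ^ 2 * hdet v := by
  rw [Matrix.det_fin_two]
  simp only [hdet, act1]
  ring

lemma hdet_sw12 (v : H3) : hdet (sw12 v) = hdet v := by
  simp only [hdet, sw12_apply]; ring

lemma hdet_sw13 (v : H3) : hdet (sw13 v) = hdet v := by
  simp only [hdet, sw13_apply]; ring

lemma hdet_act2 (U : Matrix (Fin 2) (Fin 2) ℂ) (v : H3) :
    hdet (act2 U v) = U.det ^ 2 * hdet v := by
  rw [← hdet_sw12, sw12_act2, hdet_act1, hdet_sw12]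

lemma hdet_act3 (U : Matrix (Fin 2) (Fin 2) ℂ) (v : H3) :
    hdet (act3 U v) = U.det ^ 2 * hdet v := by
  rw [← hdet_sw13, sw13_act3, hdet_act1, hdet_sw13]

lemma norm_det_unitary {U : Matrix (Fin 2) (Fin 2) ℂ}
    (hU : U ∈ Matrix.unitaryGroup (Fin 2) ℂ) : ‖U.det‖ = 1 :=
  CStarRing.norm_of_mem_unitary (Matrix.det_of_mem_unitary hU)

lemma LU_hdet {v w : H3} (h : LUequiv v w) : ‖hdet w‖ = ‖hdet v‖ := by
  obtain ⟨A, B, C, hA, hB, hC, rfl⟩ := h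
  rw [tensor3_eq, hdet_act1, hdet_act2, hdet_act3]
  simp [norm_det_unitary hA, norm_det_unitary hB, norm_det_unitary hC]

/-- The smaller root of `x (1 - x - T) + A T = p (1 - p)`. -/
noncomputable def root (p : ℝ) (z : ℝ × ℝ) : ℝ :=
  ((1 - z.2) - Real.sqrt ((1 - z.2) ^ 2 - 4 * (p * (1 - p) - z.1 * z.2))) / 2

lemma root_cont (p : ℝ) : Continuous (root p) := by
  unfold root; fun_prop

lemma root_zero {p : ℝ} (hp : p < 1 / 2) (A : ℝ) : root p (A, 0) = p := by
  have : (1 - (0 : ℝ)) ^ 2 - 4 * (p * (1 - p) - A * 0) = (1 - 2 * p) ^ 2 := by ring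
  simp only [root]
  rw [this, Real.sqrt_sq (by linarith)]
  ring

lemma root_spec {p : ℝ} {z : ℝ × ℝ} (h : 0 < (1 - z.2) ^ 2 - 4 * (p * (1 - p) - z.1 * z.2)) :
    root p z * (1 - root p z - z.2) + z.1 * z.2 = p * (1 - p) := by
  have := Real.sq_sqrt h.le
  simp only [root]
  nlinarith

lemma exists_params {p q r : ℝ} (hp : p < 1 / 2) (hq : q < 1 / 2) (hr : r < 1 / 2)
    (h1 : p < q + r) (h2 : q < p + r) (h3 : r < p + q) :
    ∃ A B C D T : ℝ, 0 < A ∧ 0 < B ∧ 0 < C ∧ 0 < D ∧ 0 < T ∧ A + B + C + D + T = 1 ∧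
      (C + D + T) * (A + B) - B * T = p * (1 - p) ∧
      (B + D + T) * (A + C) - C * T = q * (1 - q) ∧
      (B + C + T) * (A + D) - D * T = r * (1 - r) := by
  set A0 : ℝ := 1 - (p + q + r) / 2 with hA0
  have cp := root_cont p
  have cq := root_cont q
  have cr := root_cont r
  have disc : ∀ s : ℝ, s < 1 / 2 → ∀ᶠ z : ℝ × ℝ in nhds (A0, 0),
      0 < (1 - z.2) ^ 2 - 4 * (s * (1 - s) - z.1 * z.2) := by
    intro s hs
    have hc : Continuous fun z : ℝ × ℝ => (1 - z.2) ^ 2 - 4 * (s * (1 - s) - z.1 * z.2) := by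
      fun_prop
    refine hc.continuousAt.eventually (lt_mem_nhds ?_)
    simp only
    nlinarith [mul_pos (sub_pos.2 hs) (sub_pos.2 hs)]
  have pos : ∀ f : ℝ × ℝ → ℝ, Continuous f → 0 < f (A0, 0) →
      ∀ᶠ z : ℝ × ℝ in nhds (A0, 0), 0 < f z := fun f hf h0 =>
    hf.continuousAt.eventually (lt_mem_nhds h0)
  have eB := pos (fun z => (root q z + root r z - root p z) / 2) (by fun_prop)
    (by simp only [root_zero hp, root_zero hq, root_zero hr]; linarith)
  have eC := pos (fun z => (root p z + root r z - root q z) / 2) (by fun_prop)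
    (by simp only [root_zero hp, root_zero hq, root_zero hr]; linarith)
  have eD := pos (fun z => (root p z + root q z - root r z) / 2) (by fun_prop)
    (by simp only [root_zero hp, root_zero hq, root_zero hr]; linarith)
  have eA := pos (fun z => z.1) (by fun_prop) (by simp only; linarith)
  have eall := ((((((disc p hp).and (disc q hq)).and (disc r hr)).and eA).and eB).and eC).and eD
  obtain ⟨δ, hδ, hball⟩ := Metric.eventually_nhds_iff.1 eall
  -- the remaining equation
  set F : ℝ × ℝ → ℝ := fun z => z.1 + z.2 + (root p z + root q z + root r z) / 2 - 1 with hF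
  have hFc : Continuous F := by rw [hF]; fun_prop
  have hF0 : ∀ A, F (A, 0) = A - A0 := by
    intro A
    simp only [hF, root_zero hp, root_zero hq, root_zero hr, hA0]; ring
  have hlo : ∀ᶠ T in nhds (0 : ℝ), F (A0 - δ / 2, T) < 0 := by
    have hc : Continuous fun T : ℝ => F (A0 - δ / 2, T) := by fun_prop
    exact hc.continuousAt.eventually (gt_mem_nhds (by beta_reduce; rw [hF0]; linarith))
  have hhi : ∀ᶠ T in nhds (0 : ℝ), 0 < F (A0 + δ / 2, T) := by
    have hc : Continuous fun T : ℝ => F (A0 + δ / 2, T) := by fun_prop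
    exact hc.continuousAt.eventually (lt_mem_nhds (by beta_reduce; rw [hF0]; linarith))
  obtain ⟨ε, hε, hε'⟩ := Metric.eventually_nhds_iff.1 (hlo.and hhi)
  set T := min (δ / 2) (ε / 2) with hT
  have hT0 : 0 < T := lt_min (by linarith) (by linarith)
  have hTδ : T ≤ δ / 2 := min_le_left _ _
  have hTε : T ≤ ε / 2 := min_le_right _ _
  obtain ⟨l1, l2⟩ := hε' (y := T) (by rw [Real.dist_eq, sub_zero, abs_of_pos hT0]; linarith)
  have hcT : Continuous fun A : ℝ => F (A, T) := by fun_prop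
  obtain ⟨A, hA, hFA⟩ := intermediate_value_Icc (by linarith : A0 - δ / 2 ≤ A0 + δ / 2)
    hcT.continuousOn (show (0 : ℝ) ∈ Set.Icc (F (A0 - δ / 2, T)) (F (A0 + δ / 2, T)) from
      ⟨l1.le, l2.le⟩)
  have hd : dist (A, T) (A0, (0 : ℝ)) < δ := by
    rw [Prod.dist_eq]
    refine max_lt ?_ ?_
    · rw [Real.dist_eq, abs_lt]; constructor <;> linarith [hA.1, hA.2]
    · rw [Real.dist_eq, sub_zero, abs_of_pos hT0]; linarith
  obtain ⟨⟨⟨⟨⟨⟨d1, d2⟩, d3⟩, gA⟩, gB⟩, gC⟩, gD⟩ := hball hd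
  have s1 := root_spec d1
  have s2 := root_spec d2
  have s3 := root_spec d3
  simp only [hF] at hFA s1 s2 s3 gA gB gC gD
  set x := root p (A, T)
  set y := root q (A, T)
  set z := root r (A, T)
  have hAe : A = 1 - T - (x + y + z) / 2 := by linarith
  refine ⟨A, (y + z - x) / 2, (x + z - y) / 2, (x + y - z) / 2, T, gA, gB, gC, gD, hT0,
    by linarith, ?_, ?_, ?_⟩
  · rw [← s1, hAe]; ring
  · rw [← s2, hAe]; ring
  · rw [← s3, hAe]; ring

/-- Five-term states. -/
noncomputable def five (a b c d t : ℂ) : H3 := fun x =>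
  if x = (0,0,0) then a else if x = (0,1,1) then b else if x = (1,0,1) then c else
  if x = (1,1,0) then d else if x = (1,1,1) then t else 0

lemma five_spec {A B C D T p q r : ℝ} {a b c d t : ℂ} (hp : p < 1 / 2) (hq : q < 1 / 2)
    (hr : r < 1 / 2)
    (ha : Complex.normSq a = A) (hb : Complex.normSq b = B) (hc : Complex.normSq c = C)
    (hd : Complex.normSq d = D) (ht : Complex.normSq t = T) (h : A + B + C + D + T = 1)
    (h1 : (C + D + T) * (A + B) - B * T = p * (1 - p))
    (h2 : (B + D + T) * (A + C) - C * T = q * (1 - q))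
    (h3 : (B + C + T) * (A + D) - D * T = r * (1 - r)) :
    normSq3 (five a b c d t) = 1 ∧ p1 (five a b c d t) = p ∧ p2 (five a b c d t) = q ∧
      p3 (five a b c d t) = r ∧ hdet (five a b c d t) = a ^ 2 * t ^ 2 + 4 * (a * b * c * d) := by
  set v := five a b c d t with hv
  have v000 : v (0,0,0) = a := by simp [hv, five]
  have v001 : v (0,0,1) = 0 := by simp [hv, five]
  have v010 : v (0,1,0) = 0 := by simp [hv, five]
  have v011 : v (0,1,1) = b := by simp [hv, five]
  have v100 : v (1,0,0) = 0 := by simp [hv, five]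
  have v101 : v (1,0,1) = c := by simp [hv, five]
  have v110 : v (1,1,0) = d := by simp [hv, five]
  have v111 : v (1,1,1) = t := by simp [hv, five]
  clear_value v
  have hn : normSq3 v = 1 := by
    rw [normSq3_expand, v000, v001, v010, v011, v100, v101, v110, v111, map_zero,
      ha, hb, hc, hd, ht]
    linarith
  have uniq : ∀ s s' : ℝ, s ≤ 1 / 2 → s' < 1 / 2 → s * (1 - s) = s' * (1 - s') → s = s' := by
    intro s s' i1 i2 i3
    have : (s - s') * (1 - s - s') = 0 := by linarith
    rcases mul_eq_zero.1 this with e | e <;> linarith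
  refine ⟨hn, ?_, ?_, ?_, ?_⟩
  · obtain ⟨e1, e2⟩ := dens1 hn
    apply uniq _ _ e1 hp
    have o : rho1 v 0 1 = b * star t := by
      simp [rho1, Fin.sum_univ_two, v000, v001, v010, v011, v100, v101, v110, v111]
    rw [e2, o, rho1_11, v100, v101, v110, v111, ← h1, map_mul, Complex.star_def,
      Complex.normSq_conj, hc, hd, ht, hb, map_zero]
    have : A = 1 - B - C - D - T := by linarith
    rw [this]; ring
  · obtain ⟨e1, e2⟩ := dens2 hn
    apply uniq _ _ e1 hq
    have o : rho2 v 0 1 = c * star t := by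
      simp [rho2, Fin.sum_univ_two, v000, v001, v010, v011, v100, v101, v110, v111]
    rw [e2, o, rho2_11, v010, v011, v110, v111, ← h2, map_mul, Complex.star_def,
      Complex.normSq_conj, hc, hd, ht, hb, map_zero]
    have : A = 1 - B - C - D - T := by linarith
    rw [this]; ring
  · obtain ⟨e1, e2⟩ := dens3 hn
    apply uniq _ _ e1 hr
    have o : rho3 v 0 1 = d * star t := by
      simp [rho3, Fin.sum_univ_two, v000, v001, v010, v011, v100, v101, v110, v111]
    rw [e2, o, rho3_11, v001, v011, v101, v111, ← h3, map_mul, Complex.star_def,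
      Complex.normSq_conj, hc, hd, ht, hb, map_zero]
    have : A = 1 - B - C - D - T := by linarith
    rw [this]; ring
  · simp only [hdet, v000, v001, v010, v011, v100, v101, v110, v111]; ring

lemma canon_unique {v w : H3} (hv : Canon v) (hw : Canon w) (h1 : p1 w = p1 v)
    (h2 : p2 w = p2 v) (h3 : p3 w = p3 v) : LUequiv v w := by
  obtain ⟨u, hu, he, a, b, c, d⟩ := hv
  obtain ⟨u', hu', he', a', b', c', d'⟩ := hw
  rw [h1, h2, h3] at a' b' c' d'
  exact hu.trans ((even_equiv he he' (by rw [a, a']) (by rw [b, b']) (by rw [c, c'])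
    (by rw [d, d'])).trans hu'.symm)

lemma facet2 {v : H3} (hv : normSq3 v = 1) :
    p2 v ≤ p1 v + p3 v ∧ (p2 v = p1 v + p3 v → Canon v) := by
  obtain ⟨h1, h2⟩ := facet (v := sw12 v) (by rw [normSq3_sw12, hv])
  rw [p1_sw12, p2_sw12, p3_sw12] at h1 h2
  exact ⟨h1, fun h => canon_sw12 (h2 h)⟩

lemma facet3 {v : H3} (hv : normSq3 v = 1) :
    p3 v ≤ p1 v + p2 v ∧ (p3 v = p1 v + p2 v → Canon v) := by
  obtain ⟨h1, h2⟩ := facet (v := sw13 v) (by rw [normSq3_sw13, hv])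
  rw [p1_sw13, p2_sw13, p3_sw13] at h1 h2
  exact ⟨by linarith, fun h => canon_sw13 (h2 (by linarith))⟩

lemma boundary_canon {v : H3} (hv : normSq3 v = 1)
    (h : p1 v = 1 / 2 ∨ p2 v = 1 / 2 ∨ p3 v = 1 / 2 ∨
        p1 v = p2 v + p3 v ∨ p2 v = p1 v + p3 v ∨ p3 v = p1 v + p2 v) : Canon v := by
  rcases h with h | h | h | h | h | h
  · exact half_canon hv h
  · exact canon_sw12 (half_canon (by rw [normSq3_sw12, hv]) (by rw [p1_sw12, h]))
  · exact canon_sw13 (half_canon (by rw [normSq3_sw13, hv]) (by rw [p1_sw13, h]))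
  · exact (facet hv).2 h
  · exact (facet2 hv).2 h
  · exact (facet3 hv).2 h

lemma normSq_sqrt {A : ℝ} (hA : 0 < A) : Complex.normSq ((Real.sqrt A : ℝ) : ℂ) = A := by
  rw [Complex.normSq_ofReal, Real.mul_self_sqrt hA.le]

/-- a pure three-qubit state is determined up to local unitaries by its
local spectra if and only if its local minimal eigenvalues lie on the boundary of the
Kirwan polytope. -/
theorem determined_by_local_spectra_iff_boundary_of_Kirwan_polytope
    (v : H3) (hv : normSq3 v = 1) :
    (∀ w : H3, normSq3 w = 1 → p1 w = p1 v → p2 w = p2 v → p3 w = p3 v → LUequiv v w) ↔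
      (p1 v = 1 / 2 ∨ p2 v = 1 / 2 ∨ p3 v = 1 / 2 ∨
        p1 v = p2 v + p3 v ∨ p2 v = p1 v + p3 v ∨ p3 v = p1 v + p2 v) := by
  constructor
  · intro hdet_all
    by_contra hcon
    push Not at hcon
    obtain ⟨n1, n2, n3, n4, n5, n6⟩ := hcon
    have hp := lt_of_le_of_ne (dens1 hv).1 n1
    have hq := lt_of_le_of_ne (dens2 hv).1 n2
    have hr := lt_of_le_of_ne (dens3 hv).1 n3
    obtain ⟨A, B, C, D, T, hA, hB, hC, hD, hT, hs, e1, e2, e3⟩ := exists_params hp hq hr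
      (lt_of_le_of_ne (facet hv).1 n4) (lt_of_le_of_ne (facet2 hv).1 n5)
      (lt_of_le_of_ne (facet3 hv).1 n6)
    have hT' : Complex.normSq (((Real.sqrt T : ℝ) : ℂ) * Complex.I) = T := by
      rw [map_mul, normSq_sqrt hT, Complex.normSq_I, mul_one]
    obtain ⟨f0, f1, f2, f3, f4⟩ := five_spec hp hq hr (normSq_sqrt hA) (normSq_sqrt hB)
      (normSq_sqrt hC) (normSq_sqrt hD) (normSq_sqrt hT) hs e1 e2 e3
    obtain ⟨g0, g1, g2, g3, g4⟩ := five_spec hp hq hr (normSq_sqrt hA) (normSq_sqrt hB)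
      (normSq_sqrt hC) (normSq_sqrt hD) hT' hs e1 e2 e3
    have k1 := LU_hdet (hdet_all _ f0 f1 f2 f3)
    have k2 := LU_hdet (hdet_all _ g0 g1 g2 g3)
    rw [← k2, f4, g4] at k1
    have a0 := Real.sqrt_pos.2 hA
    have b0 := Real.sqrt_pos.2 hB
    have c0 := Real.sqrt_pos.2 hC
    have d0 := Real.sqrt_pos.2 hD
    have t0 := Real.sqrt_pos.2 hT
    set a := Real.sqrt A
    set b := Real.sqrt B
    set c := Real.sqrt C
    set d := Real.sqrt D
    set t := Real.sqrt T
    have l1 : (a : ℂ) ^ 2 * (t : ℂ) ^ 2 + 4 * (a * b * c * d) =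
        ((a ^ 2 * t ^ 2 + 4 * (a * b * c * d) : ℝ) : ℂ) := by push_cast; ring
    have l2 : (a : ℂ) ^ 2 * ((t : ℂ) * Complex.I) ^ 2 + 4 * (a * b * c * d) =
        ((-(a ^ 2 * t ^ 2) + 4 * (a * b * c * d) : ℝ) : ℂ) := by
      rw [mul_pow, Complex.I_sq]; push_cast; ring
    rw [l1, l2, Complex.norm_real, Complex.norm_real, Real.norm_eq_abs, Real.norm_eq_abs,
      ← sq_eq_sq_iff_abs_eq_abs] at k1
    have m1 : 0 < a ^ 2 * t ^ 2 := by positivity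
    have m2 : 0 < a * b * c * d := by positivity
    nlinarith [mul_pos m1 m2]
  · intro h w hw h1 h2 h3
    exact canon_unique (boundary_canon hv h) (boundary_canon hw (by rw [h1, h2, h3]; exact h))
      h1 h2 h3
end

section
/- The set {(p₁(v), p₂(v), p₃(v)) : v ∈ X_W, ‖v‖ = 1} ⊆ ℝ³ is equal to the convex hull of the four points (0,0,0), (0,1/2,1/2), (1/2,0,1/2), and (1/2,1/2,0). In particular, the Kirwan polytope of the closure of the W SLOCC class is of maximal dimension. -/
open scoped BigOperators

open Complex ComplexConjugate

lemma kw_minEig_isLeast (ρ : Matrix (Fin 2) (Fin 2) ℂ) (a d : ℝ) (b : ℂ)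
    (h00 : ρ 0 0 = a) (h11 : ρ 1 1 = d) (h01 : ρ 0 1 = b) (h10 : ρ 1 0 = conj b) :
    minEig ρ = ((a + d) - Real.sqrt ((a - d) ^ 2 + 4 * normSq b)) / 2 := by
  have hnn : 0 ≤ (a - d) ^ 2 + 4 * normSq b := by
    have := normSq_nonneg b
    positivity
  have hs := Real.sq_sqrt hnn
  have hs0 := Real.sqrt_nonneg ((a - d) ^ 2 + 4 * normSq b)
  set s := Real.sqrt ((a - d) ^ 2 + 4 * normSq b) with hsdef
  have hmem : ∀ t : ℝ, (t : ℂ) ∈ spectrum ℂ ρ ↔ (t - a) * (t - d) - normSq b = 0 := by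
    intro t
    rw [spectrum.mem_iff, Matrix.isUnit_iff_isUnit_det, isUnit_iff_ne_zero, not_not,
      Matrix.det_fin_two]
    have : (algebraMap ℂ (Matrix (Fin 2) (Fin 2) ℂ) (t : ℂ) - ρ) 0 0 *
        (algebraMap ℂ (Matrix (Fin 2) (Fin 2) ℂ) (t : ℂ) - ρ) 1 1 -
        (algebraMap ℂ (Matrix (Fin 2) (Fin 2) ℂ) (t : ℂ) - ρ) 0 1 *
        (algebraMap ℂ (Matrix (Fin 2) (Fin 2) ℂ) (t : ℂ) - ρ) 1 0 =
        (((t - a) * (t - d) - normSq b : ℝ) : ℂ) := by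
      simp only [Matrix.sub_apply, Matrix.algebraMap_matrix_apply, h00, h01, h10, h11]
      simp [← mul_conj]
    rw [this]
    exact_mod_cast Iff.rfl
  unfold minEig
  apply IsLeast.csInf_eq
  constructor
  · simp only [Set.mem_ofPred_eq, hmem]
    nlinarith
  · intro t ht
    simp only [Set.mem_ofPred_eq, hmem] at ht
    by_contra hlt
    push Not at hlt
    nlinarith

lemma kw_qform_nonneg (A D : ℝ) (b g h : ℂ) (hA : 0 ≤ A) (hD : 0 ≤ D) (hAD : A * D = normSq b) :
    0 ≤ normSq g * A + normSq h * D + 2 * (conj g * b * h).re := by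
  have h1 : |(conj g * b * h).re| ≤ ‖conj g * b * h‖ := Complex.abs_re_le_norm _
  have h2 : ‖conj g * b * h‖ = ‖g‖ * ‖b‖ * ‖h‖ := by simp
  have h3 : ‖b‖ = Real.sqrt A * Real.sqrt D := by
    rw [← Real.sqrt_mul hA, hAD, normSq_eq_norm_sq, Real.sqrt_sq (norm_nonneg _)]
  rw [normSq_eq_norm_sq, normSq_eq_norm_sq]
  have h4 := Real.sq_sqrt hA
  have h5 := Real.sq_sqrt hD
  have h6 := (abs_le.1 h1).1
  rw [h2, h3] at h6
  nlinarith [sq_nonneg (‖g‖ * Real.sqrt A - ‖h‖ * Real.sqrt D)]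

lemma kw_min_props (a d : ℝ) (b : ℂ) :
    let m := ((a + d) - Real.sqrt ((a - d) ^ 2 + 4 * normSq b)) / 2
    0 ≤ a - m ∧ 0 ≤ d - m ∧ (a - m) * (d - m) = normSq b := by
  intro m
  have hb := normSq_nonneg b
  have hnn : 0 ≤ (a - d) ^ 2 + 4 * normSq b := by positivity
  have hs := Real.sq_sqrt hnn
  have hs0 := Real.sqrt_nonneg ((a - d) ^ 2 + 4 * normSq b)
  have h1 : |a - d| ≤ Real.sqrt ((a - d) ^ 2 + 4 * normSq b) := by
    apply Real.abs_le_sqrt; linarith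
  have h2 := abs_le.1 h1
  refine ⟨?_, ?_, ?_⟩ <;> simp only [m] <;> nlinarith

lemma kw_min_vec (A D : ℝ) (b : ℂ) (hAD : A * D = normSq b) :
    ∃ g h : ℂ, normSq g + normSq h = 1 ∧
      normSq g * A + normSq h * D + 2 * (conj g * b * h).re = 0 := by
  by_cases h0 : normSq b + A ^ 2 = 0
  · have hb := normSq_nonneg b
    have hA : A = 0 := by nlinarith
    have hb0 : b = 0 := by
      apply normSq_eq_zero.1; nlinarith
    exact ⟨1, 0, by simp, by simp [hA]⟩
  · have hb := normSq_nonneg b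
    have hpos : 0 < normSq b + A ^ 2 := lt_of_le_of_ne (by positivity) (Ne.symm h0)
    set r := Real.sqrt (normSq b + A ^ 2) with hr
    have hr2 : r ^ 2 = normSq b + A ^ 2 := Real.sq_sqrt hpos.le
    have hr0 : r ≠ 0 := (Real.sqrt_pos.2 hpos).ne'
    refine ⟨b * ((r⁻¹ : ℝ) : ℂ), -((A * r⁻¹ : ℝ) : ℂ), ?_, ?_⟩
    · simp only [normSq_mul, normSq_neg, normSq_ofReal]
      field_simp
      linarith
    · have : (conj (b * ((r⁻¹ : ℝ) : ℂ)) * b * -((A * r⁻¹ : ℝ) : ℂ)) =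
          ((-(normSq b * r⁻¹ * (A * r⁻¹)) : ℝ) : ℂ) := by
        push_cast
        rw [← mul_conj]
        simp only [map_mul, map_inv₀, conj_ofReal]
        ring
      rw [this, ofReal_re]
      simp only [normSq_mul, normSq_neg, normSq_ofReal]
      have : A * r⁻¹ * (A * r⁻¹) * D = (A * D) * (A * r⁻¹ * r⁻¹) := by ring
      rw [this, hAD]
      ring

lemma kw_parseval (a b x y : ℂ) :
    normSq (conj a * x + conj b * y) + normSq (a * y - b * x) =
      (normSq a + normSq b) * (normSq x + normSq y) := by
  simp only [normSq_apply, add_re, add_im, sub_re, sub_im, mul_re, mul_im, conj_re, conj_im]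
  ring

/-- diagonal entry of the reduced density matrix -/
noncomputable def kwDiag (v : H3) (a : Fin 2) : ℝ :=
  ∑ b : Fin 2, ∑ c : Fin 2, normSq (v (a, b, c))

lemma kw_p1_eq (v : H3) : p1 v = ((kwDiag v 0 + kwDiag v 1) -
    Real.sqrt ((kwDiag v 0 - kwDiag v 1) ^ 2 + 4 * normSq (rho1 v 0 1))) / 2 := by
  unfold p1
  apply kw_minEig_isLeast
  · simp [rho1, kwDiag, ← mul_conj]
  · simp [rho1, kwDiag, ← mul_conj]
  · rfl
  · simp [rho1, mul_comm]

lemma kw_diag_sum (v : H3) : kwDiag v 0 + kwDiag v 1 = normSq3 v := by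
  simp only [normSq3, kwDiag, Fintype.sum_prod_type, Fin.sum_univ_two]

lemma kw_quad (v : H3) (g h : ℂ) :
    ∑ b : Fin 2, ∑ c : Fin 2, normSq (conj g * v (0, b, c) + conj h * v (1, b, c)) =
      normSq g * kwDiag v 0 + normSq h * kwDiag v 1 + 2 * (conj g * rho1 v 0 1 * h).re := by
  have key : ∀ x y : ℂ, normSq (conj g * x + conj h * y) =
      normSq g * normSq x + normSq h * normSq y + 2 * (conj g * (x * conj y) * h).re := by
    intro x y
    simp only [normSq_apply, add_re, add_im, mul_re, mul_im, conj_re, conj_im]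
    ring
  simp only [key, kwDiag, rho1, Fin.sum_univ_two, Matrix.of_apply, star_def, mul_add, add_mul,
    add_re]
  ring

lemma kw_p1_le (v : H3) (g h : ℂ) : p1 v * (normSq g + normSq h) ≤
    ∑ b : Fin 2, ∑ c : Fin 2, normSq (conj g * v (0, b, c) + conj h * v (1, b, c)) := by
  rw [kw_quad, kw_p1_eq]
  obtain ⟨h1, h2, h3⟩ := kw_min_props (kwDiag v 0) (kwDiag v 1) (rho1 v 0 1)
  have := kw_qform_nonneg _ _ (rho1 v 0 1) g h h1 h2 h3
  nlinarith

lemma kw_p1_ex (v : H3) : ∃ g h : ℂ, normSq g + normSq h = 1 ∧ p1 v =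
    ∑ b : Fin 2, ∑ c : Fin 2, normSq (conj g * v (0, b, c) + conj h * v (1, b, c)) := by
  obtain ⟨h1, h2, h3⟩ := kw_min_props (kwDiag v 0) (kwDiag v 1) (rho1 v 0 1)
  obtain ⟨g, h, hu, hq⟩ := kw_min_vec _ _ (rho1 v 0 1) h3
  refine ⟨g, h, hu, ?_⟩
  rw [kw_quad, kw_p1_eq]
  have : ∀ m : ℝ, m = m * (normSq g + normSq h) := by intro m; rw [hu, mul_one]
  rw [this (_ / 2)]
  linarith

lemma kw_p2_eq (v : H3) : p2 v = p1 (fun x => v (x.2.1, x.1, x.2.2)) := rfl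
lemma kw_p3_eq (v : H3) : p3 v = p1 (fun x => v (x.2.1, x.2.2, x.1)) := rfl

lemma kw_p1_cont : Continuous p1 := by
  have : p1 = fun v => ((kwDiag v 0 + kwDiag v 1) -
    Real.sqrt ((kwDiag v 0 - kwDiag v 1) ^ 2 + 4 * normSq (rho1 v 0 1))) / 2 :=
    funext kw_p1_eq
  rw [this]
  have h0 : ∀ a, Continuous fun v => kwDiag v a := by
    intro a
    unfold kwDiag
    refine continuous_finsetSum _ fun b _ => continuous_finsetSum _ fun c _ => ?_
    exact continuous_normSq.comp (continuous_apply _)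
  have h1 : Continuous fun v => normSq (rho1 v 0 1) := by
    refine continuous_normSq.comp ?_
    simp only [rho1, Matrix.of_apply]
    refine continuous_finsetSum _ fun b _ => continuous_finsetSum _ fun c _ => ?_
    exact (continuous_apply _).mul (continuous_star.comp (continuous_apply _))
  have := h0 0
  have := h0 1
  fun_prop

lemma kw_p2_cont : Continuous p2 := by
  rw [show p2 = fun v => p1 (fun x => v (x.2.1, x.1, x.2.2)) from funext kw_p2_eq]
  refine kw_p1_cont.comp ?_
  exact continuous_pi fun x => continuous_apply _

lemma kw_p3_cont : Continuous p3 := by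
  rw [show p3 = fun v => p1 (fun x => v (x.2.1, x.2.2, x.1)) from funext kw_p3_eq]
  refine kw_p1_cont.comp ?_
  exact continuous_pi fun x => continuous_apply _

lemma kw_normSq3_cont : Continuous normSq3 := by
  unfold normSq3
  exact continuous_finsetSum _ fun b _ => continuous_normSq.comp (continuous_apply _)

lemma kw_p1_nonneg (v : H3) : 0 ≤ p1 v := by
  obtain ⟨g, h, -, e⟩ := kw_p1_ex v
  rw [e]
  exact Finset.sum_nonneg fun _ _ => Finset.sum_nonneg fun _ _ => normSq_nonneg _

/-- maximal eigenvalue bound -/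
lemma kw_p1_le' (v : H3) (g h : ℂ) :
    ∑ b : Fin 2, ∑ c : Fin 2, normSq (conj g * v (0, b, c) + conj h * v (1, b, c)) ≤
    (normSq3 v - p1 v) * (normSq g + normSq h) := by
  have h1 := kw_p1_le v (-conj h) (conj g)
  have h2 : (normSq g + normSq h) * normSq3 v =
    ∑ b : Fin 2, ∑ c : Fin 2, normSq (conj g * v (0, b, c) + conj h * v (1, b, c)) +
    ∑ b : Fin 2, ∑ c : Fin 2,
      normSq (conj (-conj h) * v (0, b, c) + conj (conj g) * v (1, b, c)) := by
    have e : ∀ x y : ℂ, conj (-conj h) * x + conj (conj g) * y = g * y - h * x := by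
      intro x y; simp; ring
    simp only [e, Fin.sum_univ_two, ← kw_diag_sum, kwDiag]
    linarith [kw_parseval g h (v (0,0,0)) (v (1,0,0)), kw_parseval g h (v (0,0,1)) (v (1,0,1)),
      kw_parseval g h (v (0,1,0)) (v (1,1,0)), kw_parseval g h (v (0,1,1)) (v (1,1,1))]
  simp only [normSq_neg, normSq_conj] at h1
  linarith

lemma kw_polygon1 (v : H3) : p1 v ≤ p2 v + p3 v := by
  obtain ⟨g, h, hu, e2⟩ := kw_p1_ex (fun x => v (x.2.1, x.1, x.2.2))
  obtain ⟨k, l, hw, e3⟩ := kw_p1_ex (fun x => v (x.2.1, x.2.2, x.1))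
  rw [← kw_p2_eq] at e2
  rw [← kw_p3_eq] at e3
  simp only [Fin.sum_univ_two] at e2 e3
  -- x : component along the minimal eigenvector, y : orthogonal component
  set x : Fin 2 → Fin 2 → ℂ := fun a c => conj g * v (a, 0, c) + conj h * v (a, 1, c) with hx
  set y : Fin 2 → Fin 2 → ℂ := fun a c => g * v (a, 1, c) - h * v (a, 0, c) with hy
  set χ : Fin 2 → ℂ := fun a => k * y a 1 - l * y a 0 with hχ
  have P1 : ∀ a c, normSq (x a c) + normSq (y a c) = normSq (v (a,0,c)) + normSq (v (a,1,c)) := by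
    intro a c
    have := kw_parseval g h (v (a,0,c)) (v (a,1,c))
    rw [hu, one_mul] at this
    exact this
  have P2 : ∀ a, normSq (conj k * y a 0 + conj l * y a 1) + normSq (χ a)
      = normSq (y a 0) + normSq (y a 1) := by
    intro a
    have := kw_parseval k l (y a 0) (y a 1)
    rw [hw, one_mul] at this
    exact this
  have P3 : ∀ a, normSq (conj k * y a 0 + conj l * y a 1) ≤
      normSq (conj k * v (a,0,0) + conj l * v (a,0,1)) +
      normSq (conj k * v (a,1,0) + conj l * v (a,1,1)) := by
    intro a
    have := kw_parseval g h (conj k * v (a,0,0) + conj l * v (a,0,1))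
      (conj k * v (a,1,0) + conj l * v (a,1,1))
    rw [hu, one_mul] at this
    rw [← this]
    have e : conj k * y a 0 + conj l * y a 1 = g * (conj k * v (a,1,0) + conj l * v (a,1,1)) -
      h * (conj k * v (a,0,0) + conj l * v (a,0,1)) := by
      simp only [hy]; ring
    rw [e]
    linarith [normSq_nonneg (conj g * (conj k * v (a,0,0) + conj l * v (a,0,1)) +
      conj h * (conj k * v (a,1,0) + conj l * v (a,1,1)))]
  have hN : normSq3 v - p2 v - p3 v ≤ normSq (χ 0) + normSq (χ 1) := by
    rw [← kw_diag_sum, e2, e3]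
    simp only [kwDiag, Fin.sum_univ_two]
    have := P1 0 0; have := P1 0 1; have := P1 1 0; have := P1 1 1
    have := P2 0; have := P2 1
    have := P3 0; have := P3 1
    simp only [hx] at *
    linarith
  have hmax := kw_p1_le' v (χ 0) (χ 1)
  have P4 : (normSq (χ 0) + normSq (χ 1)) ^ 2 ≤
    ∑ b : Fin 2, ∑ c : Fin 2,
      normSq (conj (χ 0) * v (0, b, c) + conj (χ 1) * v (1, b, c)) := by
    set z : Fin 2 → Fin 2 → ℂ :=
      fun b c => conj (χ 0) * v (0, b, c) + conj (χ 1) * v (1, b, c) with hz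
    have a0 := kw_parseval g h (z 0 0) (z 1 0)
    have a1 := kw_parseval g h (z 0 1) (z 1 1)
    have a2 := kw_parseval k l (g * z 1 0 - h * z 0 0) (g * z 1 1 - h * z 0 1)
    rw [hu] at a0 a1
    rw [hw] at a2
    have e : k * (g * z 1 1 - h * z 0 1) - l * (g * z 1 0 - h * z 0 0) =
        ((normSq (χ 0) + normSq (χ 1) : ℝ) : ℂ) := by
      push_cast
      rw [normSq_eq_conj_mul_self, normSq_eq_conj_mul_self]
      have : ∀ a, χ a = k * (g * v (a, 1, 1) - h * v (a, 0, 1)) -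
        l * (g * v (a, 1, 0) - h * v (a, 0, 0)) := fun a => rfl
      simp only [hz]
      rw [mul_comm (conj (χ 0)) (χ 0), mul_comm (conj (χ 1)) (χ 1)]
      generalize conj (χ 0) = c0
      generalize conj (χ 1) = c1
      rw [this 0, this 1]
      ring
    rw [e, normSq_ofReal] at a2
    simp only [Fin.sum_univ_two]
    have n1 := normSq_nonneg (conj g * z 0 0 + conj h * z 1 0)
    have n2 := normSq_nonneg (conj g * z 0 1 + conj h * z 1 1)
    have n3 := normSq_nonneg (conj k * (g * z 1 0 - h * z 0 0) + conj l * (g * z 1 1 - h * z 0 1))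
    nlinarith
  have hX : 0 ≤ normSq (χ 0) + normSq (χ 1) := add_nonneg (normSq_nonneg _) (normSq_nonneg _)
  rcases hX.eq_or_lt with hX0 | hX0
  · have := kw_p1_le' v 1 0
    have h5 : 0 ≤ ∑ b : Fin 2, ∑ c : Fin 2,
      normSq (conj 1 * v (0, b, c) + conj 0 * v (1, b, c)) :=
      Finset.sum_nonneg fun _ _ => Finset.sum_nonneg fun _ _ => normSq_nonneg _
    simp only [normSq_one, normSq_zero] at this
    linarith
  · have : normSq (χ 0) + normSq (χ 1) ≤ normSq3 v - p1 v := by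
      by_contra hc
      push Not at hc
      nlinarith
    linarith

lemma kw_polygon2 (v : H3) : p2 v ≤ p1 v + p3 v := by
  have h := kw_polygon1 (fun x => v (x.2.1, x.1, x.2.2))
  have e1 : p1 (fun x => v (x.2.1, x.1, x.2.2)) = p2 v := rfl
  have e2 : p2 (fun x => v (x.2.1, x.1, x.2.2)) = p1 v := rfl
  have e3 : p3 (fun x => v (x.2.1, x.1, x.2.2)) = p3 v := by
    unfold p3
    congr 1
    ext c c'
    simp only [rho3, Matrix.of_apply, Fin.sum_univ_two]
    ring
  linarith

lemma kw_polygon3 (v : H3) : p3 v ≤ p1 v + p2 v := by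
  have h := kw_polygon1 (fun x => v (x.2.1, x.2.2, x.1))
  have e1 : p1 (fun x => v (x.2.1, x.2.2, x.1)) = p3 v := rfl
  have e2 : p2 (fun x => v (x.2.1, x.2.2, x.1)) = p1 v := by
    unfold p2 p1
    congr 1
    ext c c'
    simp only [rho2, rho1, Matrix.of_apply, Fin.sum_univ_two]
    ring
  have e3 : p3 (fun x => v (x.2.1, x.2.2, x.1)) = p2 v := by
    unfold p3 p2
    congr 1
    ext c c'
    simp only [rho3, rho2, Matrix.of_apply, Fin.sum_univ_two]
    ring
  linarith

lemma kw_pos_of_det (A : Matrix (Fin 2) (Fin 2) ℂ) (hA : A.det = 1) :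
    0 < normSq (A 0 0) + normSq (A 1 0) := by
  have h0 := normSq_nonneg (A 0 0)
  have h1 := normSq_nonneg (A 1 0)
  rcases (add_nonneg h0 h1).eq_or_lt with h | h
  · have e0 : A 0 0 = 0 := normSq_eq_zero.1 (by linarith)
    have e1 : A 1 0 = 0 := normSq_eq_zero.1 (by linarith)
    rw [Matrix.det_fin_two, e0, e1] at hA
    simp at hA
  · exact h

lemma kw_W_apply (A1 A2 A3 : Matrix (Fin 2) (Fin 2) ℂ) (l : ℂ) (a b c : Fin 2) :
    (l • tensor3 A1 A2 A3 wState) (a, b, c) = (l * ((1 / Real.sqrt 3 : ℝ) : ℂ)) *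
      (A1 a 1 * A2 b 0 * A3 c 0 + A1 a 0 * A2 b 1 * A3 c 0 + A1 a 0 * A2 b 0 * A3 c 1) := by
  simp only [Pi.smul_apply, smul_eq_mul, tensor3, wState, Fin.sum_univ_two]
  simp
  ring

lemma kw_sum_le_of_WClass (v : H3) (hv : v ∈ WClass) : p1 v + p2 v + p3 v ≤ normSq3 v := by
  obtain ⟨A1, A2, A3, l, d1, d2, d3, -, rfl⟩ := hv
  set v := l • tensor3 A1 A2 A3 wState with hvdef
  set k := l * ((1 / Real.sqrt 3 : ℝ) : ℂ) with hk
  have hv : ∀ a b c, v (a, b, c) = k *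
      (A1 a 1 * A2 b 0 * A3 c 0 + A1 a 0 * A2 b 1 * A3 c 0 + A1 a 0 * A2 b 0 * A3 c 1) :=
    kw_W_apply A1 A2 A3 l
  clear_value v k
  have hA := kw_pos_of_det A1 d1
  have hB := kw_pos_of_det A2 d2
  have hC := kw_pos_of_det A3 d3
  rw [Matrix.det_fin_two] at d1 d2 d3
  set A := normSq (A1 0 0) + normSq (A1 1 0) with hAdef
  set B := normSq (A2 0 0) + normSq (A2 1 0) with hBdef
  set C := normSq (A3 0 0) + normSq (A3 1 0) with hCdef
  have q1 : ∀ b c, A1 0 0 * v (1, b, c) - A1 1 0 * v (0, b, c) = k * (A2 b 0 * A3 c 0) := by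
    intro b c
    rw [hv, hv]
    linear_combination (k * (A2 b 0 * A3 c 0)) * d1
  have q2 : ∀ a c, A2 0 0 * v (a, 1, c) - A2 1 0 * v (a, 0, c) = k * (A1 a 0 * A3 c 0) := by
    intro a c
    rw [hv, hv]
    linear_combination (k * (A1 a 0 * A3 c 0)) * d2
  have q3 : ∀ a b, A3 0 0 * v (a, b, 1) - A3 1 0 * v (a, b, 0) = k * (A1 a 0 * A2 b 0) := by
    intro a b
    rw [hv, hv]
    linear_combination (k * (A1 a 0 * A2 b 0)) * d3
  have L : ∀ g h x y : ℂ, conj (-conj h) * x + conj (conj g) * y = g * y - h * x := by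
    intro g h x y; simp; ring
  have b1 : p1 v * A ≤ normSq k * (B * C) := by
    have := kw_p1_le v (-conj (A1 1 0)) (conj (A1 0 0))
    simp only [L, q1, normSq_neg, normSq_conj, normSq_mul, Fin.sum_univ_two] at this
    rw [hAdef, hBdef, hCdef]
    linarith
  have b2 : p2 v * B ≤ normSq k * (A * C) := by
    have := kw_p1_le (fun x => v (x.2.1, x.1, x.2.2)) (-conj (A2 1 0)) (conj (A2 0 0))
    rw [← kw_p2_eq] at this
    simp only [L, q2, normSq_neg, normSq_conj, normSq_mul, Fin.sum_univ_two] at this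
    rw [hAdef, hBdef, hCdef]
    linarith
  have b3 : p3 v * C ≤ normSq k * (A * B) := by
    have := kw_p1_le (fun x => v (x.2.1, x.2.2, x.1)) (-conj (A3 1 0)) (conj (A3 0 0))
    rw [← kw_p3_eq] at this
    simp only [L, q3, normSq_neg, normSq_conj, normSq_mul, Fin.sum_univ_two] at this
    rw [hAdef, hBdef, hCdef]
    linarith
  -- Bessel
  set P : Fin 2 → Fin 2 → ℂ :=
    fun b c => conj (A1 0 0) * v (0, b, c) + conj (A1 1 0) * v (1, b, c) with hP
  have hAc : (A : ℂ) = conj (A1 0 0) * A1 0 0 + conj (A1 1 0) * A1 1 0 := by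
    rw [hAdef]; push_cast; rw [normSq_eq_conj_mul_self, normSq_eq_conj_mul_self]
  have hBc : (B : ℂ) = conj (A2 0 0) * A2 0 0 + conj (A2 1 0) * A2 1 0 := by
    rw [hBdef]; push_cast; rw [normSq_eq_conj_mul_self, normSq_eq_conj_mul_self]
  have s1 : A * normSq3 v = (normSq (P 0 0) + normSq (P 0 1) + normSq (P 1 0) + normSq (P 1 1))
      + normSq k * (B * C) := by
    have i := fun b c => kw_parseval (A1 0 0) (A1 1 0) (v (0, b, c)) (v (1, b, c))
    simp only [q1, normSq_mul] at i
    have i00 := i 0 0; have i01 := i 0 1; have i10 := i 1 0; have i11 := i 1 1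
    rw [← kw_diag_sum]
    simp only [kwDiag, Fin.sum_univ_two]
    simp only [hP, hBdef, hCdef]
    rw [← hAdef] at i00 i01 i10 i11
    linarith
  have hPe : ∀ c, A2 0 0 * P 1 c - A2 1 0 * P 0 c = k * A * A3 c 0 := by
    intro c
    have e : A2 0 0 * P 1 c - A2 1 0 * P 0 c =
      conj (A1 0 0) * (A2 0 0 * v (0, 1, c) - A2 1 0 * v (0, 0, c)) +
      conj (A1 1 0) * (A2 0 0 * v (1, 1, c) - A2 1 0 * v (1, 0, c)) := by
      simp only [hP]; ring
    rw [e, q2, q2, hAc]; ring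
  set R : Fin 2 → ℂ := fun c => conj (A2 0 0) * P 0 c + conj (A2 1 0) * P 1 c with hR
  have s2 : B * (normSq (P 0 0) + normSq (P 0 1) + normSq (P 1 0) + normSq (P 1 1)) =
      (normSq (R 0) + normSq (R 1)) + normSq k * A ^ 2 * C := by
    have i := fun c => kw_parseval (A2 0 0) (A2 1 0) (P 0 c) (P 1 c)
    simp only [hPe, normSq_mul, normSq_ofReal] at i
    have i0 := i 0; have i1 := i 1
    rw [← hBdef] at i0 i1
    simp only [hR, hCdef]
    linarith
  have hRe : A3 0 0 * R 1 - A3 1 0 * R 0 = k * A * B := by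
    have e : A3 0 0 * R 1 - A3 1 0 * R 0 =
      conj (A2 0 0) * (conj (A1 0 0) * (A3 0 0 * v (0, 0, 1) - A3 1 0 * v (0, 0, 0)) +
        conj (A1 1 0) * (A3 0 0 * v (1, 0, 1) - A3 1 0 * v (1, 0, 0))) +
      conj (A2 1 0) * (conj (A1 0 0) * (A3 0 0 * v (0, 1, 1) - A3 1 0 * v (0, 1, 0)) +
        conj (A1 1 0) * (A3 0 0 * v (1, 1, 1) - A3 1 0 * v (1, 1, 0))) := by
      simp only [hR, hP]; ring
    rw [e, q3, q3, q3, q3, hAc, hBc]; ring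
  have s3 : normSq k * A ^ 2 * B ^ 2 ≤ C * (normSq (R 0) + normSq (R 1)) := by
    have i := kw_parseval (A3 0 0) (A3 1 0) (R 0) (R 1)
    rw [hRe, ← hCdef] at i
    simp only [normSq_mul, normSq_ofReal] at i
    have := normSq_nonneg (conj (A3 0 0) * R 0 + conj (A3 1 0) * R 1)
    linarith
  have s4 : normSq k * ((B * C) ^ 2 + (A * C) ^ 2 + (A * B) ^ 2) ≤ A * B * C * normSq3 v := by
    have : A * B * C * normSq3 v = B * C * (A * normSq3 v) := by ring
    rw [this, s1]
    have : B * C * ((normSq (P 0 0) + normSq (P 0 1) + normSq (P 1 0) + normSq (P 1 1))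
      + normSq k * (B * C)) = C * (B * (normSq (P 0 0) + normSq (P 0 1) + normSq (P 1 0)
      + normSq (P 1 1))) + normSq k * (B * C) ^ 2 := by ring
    rw [this, s2]
    linarith
  have c1 := mul_le_mul_of_nonneg_right b1 (mul_pos hB hC).le
  have c2 := mul_le_mul_of_nonneg_right b2 (mul_pos hA hC).le
  have c3 := mul_le_mul_of_nonneg_right b3 (mul_pos hA hB).le
  have hABC : 0 < A * B * C := by positivity
  have : A * B * C * (p1 v + p2 v + p3 v) ≤ A * B * C * normSq3 v := by linarith
  exact le_of_mul_le_mul_left this hABC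

lemma kw_sum_le (v : H3) (hv : v ∈ closure WClass) : p1 v + p2 v + p3 v ≤ normSq3 v := by
  have hc : IsClosed {v : H3 | p1 v + p2 v + p3 v ≤ normSq3 v} :=
    isClosed_le ((kw_p1_cont.add kw_p2_cont).add kw_p3_cont) kw_normSq3_cont
  exact closure_minimal (fun v hv => kw_sum_le_of_WClass v hv) hc hv

/-- standard form -/
noncomputable def kwVec (x0 x1 x2 x3 : ℝ) : H3 := fun x =>
  if x = (0, 0, 0) then (x0 : ℂ) else if x = (1, 0, 0) then (x1 : ℂ)
  else if x = (0, 1, 0) then (x2 : ℂ) else if x = (0, 0, 1) then (x3 : ℂ) else 0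

lemma kwVec_mem_WClass (x0 y1 y2 y3 : ℝ) (h1 : 0 < y1) (h2 : 0 < y2) (h3 : 0 < y3) :
    kwVec x0 (y1 ^ 2) (y2 ^ 2) (y3 ^ 2) ∈ WClass := by
  have c1 : (y1 : ℂ) ≠ 0 := by exact_mod_cast h1.ne'
  have c2 : (y2 : ℂ) ≠ 0 := by exact_mod_cast h2.ne'
  have c3 : (y3 : ℂ) ≠ 0 := by exact_mod_cast h3.ne'
  have hs : ((Real.sqrt 3 : ℝ) : ℂ) ≠ 0 := by
    exact_mod_cast (Real.sqrt_pos.2 (by norm_num : (0:ℝ) < 3)).ne'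
  refine ⟨!![(y1 : ℂ)⁻¹, x0 / y1; 0, y1], !![(y2 : ℂ)⁻¹, 0; 0, y2], !![(y3 : ℂ)⁻¹, 0; 0, y3],
    (Real.sqrt 3 : ℝ) * (y1 * y2 * y3), ?_, ?_, ?_, ?_, ?_⟩
  · simp [Matrix.det_fin_two, c1]
  · simp [Matrix.det_fin_two, c2]
  · simp [Matrix.det_fin_two, c3]
  · exact mul_ne_zero hs (mul_ne_zero (mul_ne_zero c1 c2) c3)
  · ext ⟨a, b, c⟩
    rw [kw_W_apply]
    fin_cases a <;> fin_cases b <;> fin_cases c <;> simp [kwVec] <;> field_simp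

lemma kwVec_mem_closure (x0 x1 x2 x3 : ℝ) (h1 : 0 ≤ x1) (h2 : 0 ≤ x2) (h3 : 0 ≤ x3) :
    kwVec x0 x1 x2 x3 ∈ closure WClass := by
  have hc : Continuous fun e : ℝ => kwVec x0 (x1 + e) (x2 + e) (x3 + e) := by
    refine continuous_pi fun x => ?_
    unfold kwVec
    split_ifs <;> fun_prop
  have ht : Filter.Tendsto (fun e : ℝ => kwVec x0 (x1 + e) (x2 + e) (x3 + e))
      (nhdsWithin 0 (Set.Ioi 0)) (nhds (kwVec x0 x1 x2 x3)) := by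
    have := hc.tendsto 0
    simp only [add_zero] at this
    exact this.mono_left nhdsWithin_le_nhds
  refine mem_closure_of_tendsto ht ?_
  filter_upwards [self_mem_nhdsWithin] with e he
  have he : 0 < e := he
  have := kwVec_mem_WClass x0 (Real.sqrt (x1 + e)) (Real.sqrt (x2 + e)) (Real.sqrt (x3 + e))
    (Real.sqrt_pos.2 (by linarith)) (Real.sqrt_pos.2 (by linarith)) (Real.sqrt_pos.2 (by linarith))
  rwa [Real.sq_sqrt (by linarith), Real.sq_sqrt (by linarith), Real.sq_sqrt (by linarith)] at this

lemma kw_minEig_of (ρ : Matrix (Fin 2) (Fin 2) ℂ) (a d b p : ℝ)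
    (h00 : ρ 0 0 = a) (h11 : ρ 1 1 = d) (h01 : ρ 0 1 = (b : ℂ)) (h10 : ρ 1 0 = (b : ℂ))
    (htr : a + d = 1) (hdet : a * d - b * b = p * (1 - p)) (hp : p ≤ 1 / 2) :
    minEig ρ = p := by
  rw [kw_minEig_isLeast ρ a d b h00 h11 h01 (by rw [h10, conj_ofReal]), normSq_ofReal]
  have : (a - d) ^ 2 + 4 * (b * b) = (1 - 2 * p) ^ 2 := by
    have : d = 1 - a := by linarith
    subst this
    linarith
  rw [this, Real.sqrt_sq (by linarith)]
  linarith

lemma kwVec_p (x0 x1 x2 x3 q1 q2 q3 : ℝ) (hn : x0 ^ 2 + x1 ^ 2 + x2 ^ 2 + x3 ^ 2 = 1)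
    (h1 : x1 ^ 2 * (x2 ^ 2 + x3 ^ 2) = q1 * (1 - q1))
    (h2 : x2 ^ 2 * (x1 ^ 2 + x3 ^ 2) = q2 * (1 - q2))
    (h3 : x3 ^ 2 * (x1 ^ 2 + x2 ^ 2) = q3 * (1 - q3))
    (l1 : q1 ≤ 1 / 2) (l2 : q2 ≤ 1 / 2) (l3 : q3 ≤ 1 / 2) :
    normSq3 (kwVec x0 x1 x2 x3) = 1 ∧ p1 (kwVec x0 x1 x2 x3) = q1 ∧
      p2 (kwVec x0 x1 x2 x3) = q2 ∧ p3 (kwVec x0 x1 x2 x3) = q3 := by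
  refine ⟨?_, ?_, ?_, ?_⟩
  · simp [normSq3, Fintype.sum_prod_type, kwVec]
    linarith
  · refine kw_minEig_of _ (x0 ^ 2 + x2 ^ 2 + x3 ^ 2) (x1 ^ 2) (x0 * x1) q1 ?_ ?_ ?_ ?_
      (by linarith) (by rw [← h1]; ring) l1 <;> simp [rho1, kwVec] <;> ring
  · refine kw_minEig_of _ (x0 ^ 2 + x1 ^ 2 + x3 ^ 2) (x2 ^ 2) (x0 * x2) q2 ?_ ?_ ?_ ?_
      (by linarith) (by rw [← h2]; ring) l2 <;> simp [rho2, kwVec] <;> ring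
  · refine kw_minEig_of _ (x0 ^ 2 + x1 ^ 2 + x2 ^ 2) (x3 ^ 2) (x0 * x3) q3 ?_ ?_ ?_ ?_
      (by linarith) (by rw [← h3]; ring) l3 <;> simp [rho3, kwVec] <;> ring

lemma kw_split (s : ℝ) (h0 : 0 ≤ s) (h1 : s ≤ 1 / 4) :
    ∃ a b : ℝ, 0 ≤ a ∧ 0 ≤ b ∧ a * b = s ∧ a + b ≤ 1 := by
  have hn : 0 ≤ 1 - 4 * s := by linarith
  have h2 := Real.sq_sqrt hn
  have h3 := Real.sqrt_nonneg (1 - 4 * s)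
  have h4 : Real.sqrt (1 - 4 * s) ≤ 1 := Real.sqrt_le_one.2 (by linarith)
  refine ⟨(1 - Real.sqrt (1 - 4 * s)) / 2, (1 + Real.sqrt (1 - 4 * s)) / 2, ?_, ?_, ?_, ?_⟩ <;>
    nlinarith

lemma kw_solve (s1 s2 s3 : ℝ) (h1 : 0 ≤ s1) (h2 : 0 ≤ s2) (h3 : 0 ≤ s3)
    (l1 : s1 ≤ 1 / 4) (l2 : s2 ≤ 1 / 4) (l3 : s3 ≤ 1 / 4)
    (hF : (s1 * s2 + s1 * s3 + s2 * s3) ^ 2 ≤ s1 * s2 * s3) :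
    ∃ a1 a2 a3 : ℝ, 0 ≤ a1 ∧ 0 ≤ a2 ∧ 0 ≤ a3 ∧ a2 * a3 = s1 ∧ a1 * a3 = s2 ∧ a1 * a2 = s3 ∧
      a1 + a2 + a3 ≤ 1 := by
  by_cases hz : s1 * s2 * s3 = 0
  · have n12 := mul_nonneg h1 h2
    have n13 := mul_nonneg h1 h3
    have n23 := mul_nonneg h2 h3
    have he : s1 * s2 + s1 * s3 + s2 * s3 = 0 := by
      rw [hz] at hF
      exact pow_eq_zero_iff (two_ne_zero) |>.1 (le_antisymm hF (sq_nonneg _))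
    have e12 : s1 * s2 = 0 := by linarith
    have e13 : s1 * s3 = 0 := by linarith
    have e23 : s2 * s3 = 0 := by linarith
    by_cases z1 : s1 = 0
    · by_cases z2 : s2 = 0
      · obtain ⟨a, b, ha, hb, hab, hs⟩ := kw_split s3 h3 l3
        exact ⟨a, b, 0, ha, hb, le_rfl, by simp [z1], by simp [z2], hab, by linarith⟩
      · have z3 : s3 = 0 := by simpa [z2] using e23
        obtain ⟨a, b, ha, hb, hab, hs⟩ := kw_split s2 h2 l2
        exact ⟨a, 0, b, ha, le_rfl, hb, by simp [z1], hab, by simp [z3], by linarith⟩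
    · have z2 : s2 = 0 := by simpa [z1] using e12
      have z3 : s3 = 0 := by simpa [z1] using e13
      obtain ⟨a, b, ha, hb, hab, hs⟩ := kw_split s1 h1 l1
      exact ⟨0, a, b, le_rfl, ha, hb, hab, by simp [z2], by simp [z3], by linarith⟩
  · have n1 : s1 ≠ 0 := by rintro rfl; simp at hz
    have n2 : s2 ≠ 0 := by rintro rfl; simp at hz
    have n3 : s3 ≠ 0 := by rintro rfl; simp at hz
    have p1 : 0 < s1 := lt_of_le_of_ne h1 n1.symm
    have p2 : 0 < s2 := lt_of_le_of_ne h2 n2.symm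
    have p3 : 0 < s3 := lt_of_le_of_ne h3 n3.symm
    have hp : 0 < s1 * s2 * s3 := by positivity
    have hr := Real.sq_sqrt hp.le
    have hle := Real.le_sqrt_of_sq_le hF
    set r := Real.sqrt (s1 * s2 * s3)
    have hr0 : 0 < r := Real.sqrt_pos.2 hp
    refine ⟨r / s1, r / s2, r / s3, by positivity, by positivity, by positivity, ?_, ?_, ?_, ?_⟩
    · field_simp; linarith
    · field_simp; linarith
    · field_simp; linarith
    · have : r / s1 + r / s2 + r / s3 = (s1 * s2 + s1 * s3 + s2 * s3) / r := by
        field_simp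
        rw [hr]; ring
      rw [this, div_le_one hr0]
      exact hle

lemma kw_ident (q1 q2 q3 s1 s2 s3 : ℝ)
    (h1 : s1 = (q2 * (1 - q2) + q3 * (1 - q3) - q1 * (1 - q1)) / 2)
    (h2 : s2 = (q1 * (1 - q1) + q3 * (1 - q3) - q2 * (1 - q2)) / 2)
    (h3 : s3 = (q1 * (1 - q1) + q2 * (1 - q2) - q3 * (1 - q3)) / 2) :
    s1 * s2 * s3 - (s1 * s2 + s1 * s3 + s2 * s3) ^ 2 =
      (1 - q1 - q2 - q3) * (q2 + q3 - q1) * (q1 + q3 - q2) * (q1 + q2 - q3) *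
      ((1 + q1 - q2 - q3) * (1 + q2 - q1 - q3) * (1 + q3 - q1 - q2) * (2 - q1 - q2 - q3)) / 16 := by
  subst h1 h2 h3
  ring

lemma kw_realize (q1 q2 q3 : ℝ) (t0 : q1 + q2 + q3 ≤ 1) (t1 : q1 ≤ q2 + q3)
    (t2 : q2 ≤ q1 + q3) (t3 : q3 ≤ q1 + q2) :
    ∃ v : H3, v ∈ closure WClass ∧ normSq3 v = 1 ∧ p1 v = q1 ∧ p2 v = q2 ∧ p3 v = q3 := by
  have z1 : 0 ≤ q1 := by linarith
  have z2 : 0 ≤ q2 := by linarith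
  have z3 : 0 ≤ q3 := by linarith
  have m1 : q1 ≤ 1 / 2 := by linarith
  have m2 : q2 ≤ 1 / 2 := by linarith
  have m3 : q3 ≤ 1 / 2 := by linarith
  have w0 : 0 ≤ 1 - q1 - q2 - q3 := by linarith
  have w1 : 0 ≤ q2 + q3 - q1 := by linarith
  have w2 : 0 ≤ q1 + q3 - q2 := by linarith
  have w3 : 0 ≤ q1 + q2 - q3 := by linarith
  have y1 : 0 ≤ 1 + q1 - q2 - q3 := by linarith
  have y2 : 0 ≤ 1 + q2 - q1 - q3 := by linarith
  have y3 : 0 ≤ 1 + q3 - q1 - q2 := by linarith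
  have y0 : 0 ≤ 2 - q1 - q2 - q3 := by linarith
  have hF : 0 ≤ (1 - q1 - q2 - q3) * (q2 + q3 - q1) * (q1 + q3 - q2) * (q1 + q2 - q3) *
      ((1 + q1 - q2 - q3) * (1 + q2 - q1 - q3) * (1 + q3 - q1 - q2) * (2 - q1 - q2 - q3)) := by
    positivity
  obtain ⟨a1, a2, a3, ha1, ha2, ha3, e1, e2, e3, hs⟩ := kw_solve
    ((q2 * (1 - q2) + q3 * (1 - q3) - q1 * (1 - q1)) / 2)
    ((q1 * (1 - q1) + q3 * (1 - q3) - q2 * (1 - q2)) / 2)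
    ((q1 * (1 - q1) + q2 * (1 - q2) - q3 * (1 - q3)) / 2)
    (by nlinarith [mul_nonneg w0 w1, mul_nonneg z2 z3])
    (by nlinarith [mul_nonneg w0 w2, mul_nonneg z1 z3])
    (by nlinarith [mul_nonneg w0 w3, mul_nonneg z1 z2])
    (by nlinarith [sq_nonneg (q2 - 1 / 2), sq_nonneg (q3 - 1 / 2)])
    (by nlinarith [sq_nonneg (q1 - 1 / 2), sq_nonneg (q3 - 1 / 2)])
    (by nlinarith [sq_nonneg (q1 - 1 / 2), sq_nonneg (q2 - 1 / 2)])
    (by linarith [kw_ident q1 q2 q3 _ _ _ rfl rfl rfl])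
  have ha0 : 0 ≤ 1 - a1 - a2 - a3 := by linarith
  have := kwVec_p (Real.sqrt (1 - a1 - a2 - a3)) (Real.sqrt a1) (Real.sqrt a2) (Real.sqrt a3)
    q1 q2 q3
  rw [Real.sq_sqrt ha0, Real.sq_sqrt ha1, Real.sq_sqrt ha2, Real.sq_sqrt ha3] at this
  exact ⟨_, kwVec_mem_closure _ _ _ _ (Real.sqrt_nonneg _) (Real.sqrt_nonneg _)
    (Real.sqrt_nonneg _), this (by ring) (by linarith) (by linarith) (by linarith) m1 m2 m3⟩

lemma kw_hull (q1 q2 q3 : ℝ) : (q1, q2, q3) ∈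
    convexHull ℝ {((0 : ℝ), (0 : ℝ), (0 : ℝ)), (0, 1 / 2, 1 / 2), (1 / 2, 0, 1 / 2),
        (1 / 2, 1 / 2, 0)} ↔
    q1 + q2 + q3 ≤ 1 ∧ q1 ≤ q2 + q3 ∧ q2 ≤ q1 + q3 ∧ q3 ≤ q1 + q2 := by
  constructor
  · intro h
    have hc : Convex ℝ {q : ℝ × ℝ × ℝ | q.1 + q.2.1 + q.2.2 ≤ 1 ∧ q.1 ≤ q.2.1 + q.2.2 ∧
        q.2.1 ≤ q.1 + q.2.2 ∧ q.2.2 ≤ q.1 + q.2.1} := by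
      rintro ⟨x1, x2, x3⟩ ⟨hx0, hx1, hx2, hx3⟩ ⟨y1, y2, y3⟩ ⟨hy0, hy1, hy2, hy3⟩ a b ha hb hab
      simp only [Prod.smul_mk, Prod.mk_add_mk, smul_eq_mul, Set.mem_ofPred_eq] at *
      refine ⟨?_, ?_, ?_, ?_⟩ <;> nlinarith
    refine convexHull_min ?_ hc h
    rintro q (rfl | rfl | rfl | rfl) <;> norm_num
  · rintro ⟨t0, t1, t2, t3⟩
    set S : Set (ℝ × ℝ × ℝ) := {((0 : ℝ), (0 : ℝ), (0 : ℝ)), (0, 1 / 2, 1 / 2), (1 / 2, 0, 1 / 2),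
        (1 / 2, 1 / 2, 0)} with hS
    have hc := convex_convexHull ℝ S
    have m : ∀ i : Fin 4, (![((0 : ℝ), (0 : ℝ), (0 : ℝ)), (0, 1 / 2, 1 / 2), (1 / 2, 0, 1 / 2),
        (1 / 2, 1 / 2, 0)] : Fin 4 → ℝ × ℝ × ℝ) i ∈ convexHull ℝ S := by
      intro i
      apply subset_convexHull
      fin_cases i <;> simp [hS]
    have := hc.sum_mem (t := Finset.univ)
      (w := ![1 - q1 - q2 - q3, q2 + q3 - q1, q1 + q3 - q2, q1 + q2 - q3])
      (by intro i _; fin_cases i <;> simp <;> linarith)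
      (by simp [Fin.sum_univ_four]; ring) (fun i _ => m i)
    convert this using 1
    simp [Fin.sum_univ_four]
    refine ⟨?_, ?_, ?_⟩ <;> ring

/-- the Kirwan polytope of the closure of the W SLOCC class is the convex
hull of `(0,0,0)`, `(0,1/2,1/2)`, `(1/2,0,1/2)`, `(1/2,1/2,0)`. -/
theorem kirwan_polytope_of_W_closure :
    {q : ℝ × ℝ × ℝ | ∃ v : H3, v ∈ closure WClass ∧ normSq3 v = 1 ∧
        q = (p1 v, p2 v, p3 v)} =
      convexHull ℝ {((0 : ℝ), (0 : ℝ), (0 : ℝ)), (0, 1 / 2, 1 / 2), (1 / 2, 0, 1 / 2),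
        (1 / 2, 1 / 2, 0)} := by
  ext ⟨q1, q2, q3⟩
  rw [kw_hull]
  constructor
  · rintro ⟨v, hv, hn, hq⟩
    simp only [Prod.mk.injEq] at hq
    obtain ⟨rfl, rfl, rfl⟩ := hq
    exact ⟨hn ▸ kw_sum_le v hv, kw_polygon1 v, kw_polygon2 v, kw_polygon3 v⟩
  · rintro ⟨t0, t1, t2, t3⟩
    obtain ⟨v, hv, hn, e1, e2, e3⟩ := kw_realize q1 q2 q3 t0 t1 t2 t3
    exact ⟨v, hv, hn, by rw [e1, e2, e3]⟩
end

section
/- Let P and Q be 4×4 complex matrices indexed by Fin 2 × Fin 2 that are orthogonal projections of rank 2 (Hermitian, idempotent, rank 2). Suppose the 2×2 partial traces Tr₂P (with entries (a,a') ↦ ∑_b P((a,b),(a',b))) and Tr₂Q have the same eigenvalues, and likewise Tr₁P (with entries (b,b') ↦ ∑_a P((a,b),(a,b'))) and Tr₁Q have the same eigenvalues. Then there exist 2×2 unitary matrices U₁, U₂ such that Q = (U₁⊗U₂)·P·(U₁⊗U₂)†, where (U₁⊗U₂)((a,b),(a',b')) = U₁(a,a')·U₂(b,b'). -/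
open scoped BigOperators

/-- The Kronecker (tensor) product of two 2×2 matrices, as a matrix on `ℂ²⊗ℂ² ≅ ℂ⁴`. -/
noncomputable def kron2 (U1 U2 : Matrix (Fin 2) (Fin 2) ℂ) :
    Matrix (Fin 2 × Fin 2) (Fin 2 × Fin 2) ℂ :=
  Matrix.of fun x y => U1 x.1 y.1 * U2 x.2 y.2

/-- Partial trace over the second factor. -/
noncomputable def trace2 (P : Matrix (Fin 2 × Fin 2) (Fin 2 × Fin 2) ℂ) :
    Matrix (Fin 2) (Fin 2) ℂ :=
  Matrix.of fun a a' => ∑ b : Fin 2, P (a, b) (a', b)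

/-- Partial trace over the first factor. -/
noncomputable def trace1 (P : Matrix (Fin 2 × Fin 2) (Fin 2 × Fin 2) ℂ) :
    Matrix (Fin 2) (Fin 2) ℂ :=
  Matrix.of fun b b' => ∑ a : Fin 2, P (a, b) (a, b')

open Matrix

/-- 4×4 matrices on two qubits. -/
abbrev M4 := Matrix (Fin 2 × Fin 2) (Fin 2 × Fin 2) ℂ
/-- 2×2 matrices. -/
abbrev M2 := Matrix (Fin 2) (Fin 2) ℂ

/-- local unitary equivalence -/
def LU (P Q : M4) : Prop :=
  ∃ U1 U2 : M2, U1 ∈ Matrix.unitaryGroup (Fin 2) ℂ ∧ U2 ∈ Matrix.unitaryGroup (Fin 2) ℂ ∧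
      Q = kron2 U1 U2 * P * (kron2 U1 U2).conjTranspose

lemma kron2_eq (A B : M2) : kron2 A B = Matrix.kroneckerMap (· * ·) A B := by
  ext i j; rfl

lemma kron2_mul (A B C D : M2) : kron2 A B * kron2 C D = kron2 (A * C) (B * D) := by
  simp only [kron2_eq]
  exact (Matrix.mul_kronecker_mul A C B D).symm

lemma kron2_conj (A B : M2) : (kron2 A B)ᴴ = kron2 Aᴴ Bᴴ := by
  ext i j; simp [kron2, Matrix.conjTranspose_apply]

lemma kron2_one : kron2 1 1 = 1 := by
  simp only [kron2_eq]
  exact Matrix.one_kronecker_one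

lemma LU.trans {P Q R : M4} (h : LU P Q) (h' : LU Q R) : LU P R := by
  obtain ⟨U1, U2, hU1, hU2, rfl⟩ := h
  obtain ⟨V1, V2, hV1, hV2, rfl⟩ := h'
  refine ⟨V1 * U1, V2 * U2, mul_mem hV1 hU1, mul_mem hV2 hU2, ?_⟩
  rw [← kron2_mul, conjTranspose_mul]
  simp only [Matrix.mul_assoc]

lemma uni_l {U : M2} (h : U ∈ Matrix.unitaryGroup (Fin 2) ℂ) : Uᴴ * U = 1 :=
  Matrix.mem_unitaryGroup_iff'.1 h
lemma uni_r {U : M2} (h : U ∈ Matrix.unitaryGroup (Fin 2) ℂ) : U * Uᴴ = 1 :=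
  Matrix.mem_unitaryGroup_iff.1 h

lemma kron2_uni_l {U V : M2} (h : U ∈ Matrix.unitaryGroup (Fin 2) ℂ)
    (h' : V ∈ Matrix.unitaryGroup (Fin 2) ℂ) : (kron2 U V)ᴴ * kron2 U V = 1 := by
  rw [kron2_conj, kron2_mul, uni_l h, uni_l h', kron2_one]

lemma LU.symm {P Q : M4} (h : LU P Q) : LU Q P := by
  obtain ⟨U1, U2, hU1, hU2, rfl⟩ := h
  refine ⟨U1ᴴ, U2ᴴ, Unitary.star_mem hU1, Unitary.star_mem hU2, ?_⟩
  rw [← kron2_conj, conjTranspose_conjTranspose]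
  have h := kron2_uni_l hU1 hU2
  calc P = 1 * P * 1 := by simp
    _ = _ := by rw [← h]; simp only [Matrix.mul_assoc]

/-- orthogonal projection -/
def Good (P : M4) : Prop := P.IsHermitian ∧ P * P = P

lemma Good.conj {P : M4} (hP : Good P) {U V : M2} (h : U ∈ Matrix.unitaryGroup (Fin 2) ℂ)
    (h' : V ∈ Matrix.unitaryGroup (Fin 2) ℂ) : Good (kron2 U V * P * (kron2 U V)ᴴ) := by
  constructor
  · exact Matrix.isHermitian_mul_mul_conjTranspose _ hP.1
  · have := kron2_uni_l h h'
    calc _ = kron2 U V * P * ((kron2 U V)ᴴ * kron2 U V) * P * (kron2 U V)ᴴ := by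
          simp only [Matrix.mul_assoc]
      _ = kron2 U V * (P * P) * (kron2 U V)ᴴ := by rw [this]; simp only [Matrix.mul_assoc, Matrix.mul_one, Matrix.one_mul]
      _ = _ := by rw [hP.2]

def blk (P : M4) (a a' : Fin 2) : M2 := Matrix.of fun b b' => P (a, b) (a', b')
def blk' (P : M4) (b b' : Fin 2) : M2 := Matrix.of fun a a' => P (a, b) (a', b')

lemma blk_conj (P : M4) (U : M2) (a a' : Fin 2) :
    blk (kron2 1 U * P * (kron2 1 U)ᴴ) a a' = U * blk P a a' * Uᴴ := by
  ext i j
  fin_cases a <;> fin_cases a' <;>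
  simp [blk, kron2, Matrix.mul_apply, Fintype.sum_prod_type, Fin.sum_univ_two, Matrix.conjTranspose_apply, Matrix.one_apply]

lemma blk'_conj (P : M4) (U : M2) (a a' : Fin 2) :
    blk' (kron2 U 1 * P * (kron2 U 1)ᴴ) a a' = U * blk' P a a' * Uᴴ := by
  ext i j
  fin_cases a <;> fin_cases a' <;>
  simp [blk', kron2, Matrix.mul_apply, Fintype.sum_prod_type, Fin.sum_univ_two, Matrix.conjTranspose_apply, Matrix.one_apply]

lemma uni_sum {V : M2} (hV : V ∈ Matrix.unitaryGroup (Fin 2) ℂ) (i j : Fin 2) :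
    star (V 0 i) * V 0 j + star (V 1 i) * V 1 j = (1 : M2) i j := by
  rw [← uni_l hV]
  simp [Matrix.mul_apply, Fin.sum_univ_two, Matrix.conjTranspose_apply]

lemma trace2_conj (P : M4) {U V : M2} (hV : V ∈ Matrix.unitaryGroup (Fin 2) ℂ) :
    trace2 (kron2 U V * P * (kron2 U V)ᴴ) = U * trace2 P * Uᴴ := by
  have h00 := uni_sum hV 0 0
  have h01 := uni_sum hV 0 1
  have h10 := uni_sum hV 1 0
  have h11 := uni_sum hV 1 1
  simp at h00 h01 h10 h11
  ext i j
  simp [trace2, kron2, Matrix.mul_apply, Fintype.sum_prod_type, Fin.sum_univ_two, Matrix.conjTranspose_apply]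
  linear_combination (U i 0 * P (0, 0) (0, 0) * (starRingEnd ℂ) (U j 0) + U i 0 * P (0, 0) (1, 0) * (starRingEnd ℂ) (U j 1) + U i 1 * P (1, 0) (0, 0) * (starRingEnd ℂ) (U j 0) + U i 1 * P (1, 0) (1, 0) * (starRingEnd ℂ) (U j 1)) * h00
    + (U i 0 * P (0, 1) (0, 0) * (starRingEnd ℂ) (U j 0) + U i 0 * P (0, 1) (1, 0) * (starRingEnd ℂ) (U j 1) + U i 1 * P (1, 1) (0, 0) * (starRingEnd ℂ) (U j 0) + U i 1 * P (1, 1) (1, 0) * (starRingEnd ℂ) (U j 1)) * h01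
    + (U i 0 * P (0, 0) (0, 1) * (starRingEnd ℂ) (U j 0) + U i 0 * P (0, 0) (1, 1) * (starRingEnd ℂ) (U j 1) + U i 1 * P (1, 0) (0, 1) * (starRingEnd ℂ) (U j 0) + U i 1 * P (1, 0) (1, 1) * (starRingEnd ℂ) (U j 1)) * h10
    + (U i 0 * P (0, 1) (0, 1) * (starRingEnd ℂ) (U j 0) + U i 0 * P (0, 1) (1, 1) * (starRingEnd ℂ) (U j 1) + U i 1 * P (1, 1) (0, 1) * (starRingEnd ℂ) (U j 0) + U i 1 * P (1, 1) (1, 1) * (starRingEnd ℂ) (U j 1)) * h11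

lemma trace1_conj (P : M4) {U V : M2} (hV : U ∈ Matrix.unitaryGroup (Fin 2) ℂ) :
    trace1 (kron2 U V * P * (kron2 U V)ᴴ) = V * trace1 P * Vᴴ := by
  have h00 := uni_sum hV 0 0
  have h01 := uni_sum hV 0 1
  have h10 := uni_sum hV 1 0
  have h11 := uni_sum hV 1 1
  simp at h00 h01 h10 h11
  ext i j
  simp [trace1, kron2, Matrix.mul_apply, Fintype.sum_prod_type, Fin.sum_univ_two, Matrix.conjTranspose_apply]
  linear_combination (V i 0 * P (0, 0) (0, 0) * (starRingEnd ℂ) (V j 0) + V i 0 * P (0, 0) (0, 1) * (starRingEnd ℂ) (V j 1) + V i 1 * P (0, 1) (0, 0) * (starRingEnd ℂ) (V j 0) + V i 1 * P (0, 1) (0, 1) * (starRingEnd ℂ) (V j 1)) * h00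
    + (V i 0 * P (1, 0) (0, 0) * (starRingEnd ℂ) (V j 0) + V i 0 * P (1, 0) (0, 1) * (starRingEnd ℂ) (V j 1) + V i 1 * P (1, 1) (0, 0) * (starRingEnd ℂ) (V j 0) + V i 1 * P (1, 1) (0, 1) * (starRingEnd ℂ) (V j 1)) * h01
    + (V i 0 * P (0, 0) (1, 0) * (starRingEnd ℂ) (V j 0) + V i 0 * P (0, 0) (1, 1) * (starRingEnd ℂ) (V j 1) + V i 1 * P (0, 1) (1, 0) * (starRingEnd ℂ) (V j 0) + V i 1 * P (0, 1) (1, 1) * (starRingEnd ℂ) (V j 1)) * h10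
    + (V i 0 * P (1, 0) (1, 0) * (starRingEnd ℂ) (V j 0) + V i 0 * P (1, 0) (1, 1) * (starRingEnd ℂ) (V j 1) + V i 1 * P (1, 1) (1, 0) * (starRingEnd ℂ) (V j 0) + V i 1 * P (1, 1) (1, 1) * (starRingEnd ℂ) (V j 1)) * h11

lemma exists_phase_s14 (p q : ℂ) (h : q * star q = p * star p) : ∃ u : ℂ, u * star u = 1 ∧ q = u * p := by
  by_cases hp : p = 0
  · subst hp
    refine ⟨1, by simp, ?_⟩
    simpa using h
  · refine ⟨q / p, ?_, by field_simp⟩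
    have : star p ≠ 0 := by simpa using hp
    rw [star_div₀, div_mul_div_comm, h, div_self (mul_ne_zero hp this)]

lemma unit_sqrt (u : ℂ) (h : u * star u = 1) : ∃ e : ℂ, e * star e = 1 ∧ e * e = u := by
  obtain ⟨e, he⟩ := IsAlgClosed.exists_pow_nat_eq u (n := 2) (by norm_num)
  refine ⟨e, ?_, by rw [← he]; ring⟩
  have h1 : ‖u‖ = 1 := by
    have := congrArg norm h
    simp at this
    nlinarith [norm_nonneg u, this]
  rw [← he, norm_pow] at h1
  have h2 : ‖e‖ = 1 := by nlinarith [norm_nonneg e]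
  change e * (starRingEnd ℂ) e = 1
  rw [Complex.mul_conj, Complex.normSq_eq_norm_sq, h2]; simp

lemma uni_of (a b c d : ℂ) (h1 : a * star a + b * star b = 1) (h2 : a * star c + b * star d = 0)
    (h3 : c * star c + d * star d = 1) : !![a, b; c, d] ∈ Matrix.unitaryGroup (Fin 2) ℂ := by
  rw [Matrix.mem_unitaryGroup_iff]
  have h2' := congrArg star h2
  simp at h1 h2 h3 h2'
  ext i j
  fin_cases i <;> fin_cases j <;> simp [Matrix.mul_apply, Fin.sum_univ_two, Matrix.star_apply]
  · exact h1
  · exact h2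
  · linear_combination h2'
  · exact h3

lemma trig_aux (p q : ℝ) : ∃ c s : ℝ, c ^ 2 + s ^ 2 = 1 ∧ p * (c ^ 2 - s ^ 2) + q * (c * s) = 0 := by
  set z : ℂ := ⟨p, q / 2⟩
  refine ⟨Real.cos (z.arg / 2 + Real.pi / 4), Real.sin (z.arg / 2 + Real.pi / 4),
    Real.cos_sq_add_sin_sq _, ?_⟩
  set t := z.arg / 2 + Real.pi / 4
  have hc : Real.cos (2 * t) = - Real.sin z.arg := by
    rw [← Real.cos_add_pi_div_two]; congr 1; simp only [t]; ring
  have hs : Real.sin (2 * t) = Real.cos z.arg := by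
    rw [← Real.sin_add_pi_div_two]; congr 1; simp only [t]; ring
  have h1 : ‖z‖ * Real.cos z.arg = p := Complex.norm_mul_cos_arg z
  have h2 : ‖z‖ * Real.sin z.arg = q / 2 := Complex.norm_mul_sin_arg z
  rw [Real.cos_two_mul'] at hc
  rw [Real.sin_two_mul] at hs
  linear_combination p * hc + q / 2 * hs + Real.sin z.arg * h1 - Real.cos z.arg * h2

lemma conj_entry (U N : M2) (i j : Fin 2) : (U * N * Uᴴ) i j =
    (U i 0 * N 0 0 + U i 1 * N 1 0) * star (U j 0) + (U i 0 * N 0 1 + U i 1 * N 1 1) * star (U j 1) := by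
  simp only [Matrix.mul_apply, Fin.sum_univ_two, Matrix.conjTranspose_apply]

lemma zero_diag (N : M2) (h : N 0 0 + N 1 1 = 0) : ∃ U ∈ Matrix.unitaryGroup (Fin 2) ℂ,
    (U * N * Uᴴ) 0 0 = 0 ∧ (U * N * Uᴴ) 1 1 = 0 := by
  set n := N 0 0 with hn
  by_cases h0 : n = 0
  · refine ⟨1, one_mem _, ?_⟩
    simp only [Matrix.one_mul, Matrix.conjTranspose_one, Matrix.mul_one]
    exact ⟨h0, by simpa [h0] using h⟩
  · set A := star n * N 0 1 - star (star n * N 1 0) with hA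
    obtain ⟨w, hw, hAw⟩ := exists_phase_s14 A (‖A‖ : ℂ) (by
      change _ = A * (starRingEnd ℂ) A
      rw [Complex.mul_conj, Complex.normSq_eq_norm_sq]; simp [sq])
    set r := star n * N 0 1 * w + star n * N 1 0 * star w with hr
    have hrr : star r = r := by
      have : star (w * A) = w * A := by rw [← hAw]; simp
      simp [hA, hr] at this ⊢
      linear_combination this
    obtain ⟨q, hq⟩ : ∃ q : ℝ, (q : ℂ) = r := Complex.conj_eq_iff_real.1 hrr |>.imp fun _ h => h.symm
    obtain ⟨c, s, hcs, hf⟩ := trig_aux (‖n‖ ^ 2) q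
    have hcsC : (c : ℂ) ^ 2 + (s : ℂ) ^ 2 = 1 := by exact_mod_cast hcs
    have hnn : star n * n = ((‖n‖ ^ 2 : ℝ) : ℂ) := by
      rw [mul_comm]; change n * (starRingEnd ℂ) n = _
      rw [Complex.mul_conj, Complex.normSq_eq_norm_sq]
    have hfC : star n * n * ((c : ℂ) ^ 2 - (s : ℂ) ^ 2) + r * (c * s) = 0 := by
      rw [hnn, ← hq]; exact_mod_cast hf
    have hw' : w * (starRingEnd ℂ) w = 1 := hw
    have key : n * ((c : ℂ) ^ 2 - (s : ℂ) ^ 2) + (N 0 1 * w + N 1 0 * star w) * (c * s) = 0 := by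
      have : star n ≠ 0 := by simpa using h0
      apply mul_left_cancel₀ this
      rw [hr] at hfC
      linear_combination hfC
    have h11 : N 1 1 = - n := by linear_combination h
    have key' : n * ((c : ℂ) ^ 2 - (s : ℂ) ^ 2) + (N 0 1 * w + N 1 0 * (starRingEnd ℂ) w) * (c * s) = 0 := key
    refine ⟨!![(c:ℂ), s * star w; - s * w, c], uni_of _ _ _ _ ?_ ?_ ?_, ?_, ?_⟩
    · simp; linear_combination hcsC + s ^ 2 * hw'
    · simp; ring
    · simp; linear_combination hcsC + s ^ 2 * hw'
    · rw [conj_entry, h11, ← hn]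
      simp
      linear_combination key' - n * s ^ 2 * hw'
    · rw [conj_entry, h11, ← hn]
      simp
      linear_combination -key' + n * s ^ 2 * hw'

def TForm (P : M4) (α β : ℂ) : Prop :=
  trace2 P = Matrix.diagonal ![1 + α, 1 - α] ∧ trace1 P = Matrix.diagonal ![1 + β, 1 - β]

/-- X-shaped normal form -/
structure XF (P : M4) (α β : ℂ) : Prop where
  good : Good P
  e00 : P (0,0) (0,0) = (1 + α + β) / 2
  e11 : P (0,1) (0,1) = (1 + α - β) / 2
  e22 : P (1,0) (1,0) = (1 - α + β) / 2
  e33 : P (1,1) (1,1) = (1 - α - β) / 2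
  e01 : P (0,0) (0,1) = 0
  e02 : P (0,0) (1,0) = 0
  e13 : P (0,1) (1,1) = 0
  e23 : P (1,0) (1,1) = 0

lemma Good.idem {P : M4} (h : Good P) (i j : Fin 2 × Fin 2) :
    P i (0,0) * P (0,0) j + P i (0,1) * P (0,1) j + (P i (1,0) * P (1,0) j + P i (1,1) * P (1,1) j)
      = P i j := by
  conv_rhs => rw [← h.2]
  simp [Matrix.mul_apply, Fintype.sum_prod_type, Fin.sum_univ_two]

lemma Good.herm {P : M4} (h : Good P) (i j : Fin 2 × Fin 2) : P j i = (starRingEnd ℂ) (P i j) :=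
  (h.1.apply j i).symm

lemma XF.lu {P Q : M4} {α β : ℂ} (hP : XF P α β) (hQ : XF Q α β) : LU P Q := by
  have nP03 := hP.good.idem (0,0) (0,0)
  have nQ03 := hQ.good.idem (0,0) (0,0)
  have nP12 := hP.good.idem (0,1) (0,1)
  have nQ12 := hQ.good.idem (0,1) (0,1)
  have P10 : P (0,1) (0,0) = 0 := by rw [hP.good.herm (0,0), hP.e01, map_zero]
  have P20 : P (1,0) (0,0) = 0 := by rw [hP.good.herm (0,0), hP.e02, map_zero]
  have P31 : P (1,1) (0,1) = 0 := by rw [hP.good.herm (0,1), hP.e13, map_zero]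
  have P32 : P (1,1) (1,0) = 0 := by rw [hP.good.herm (1,0), hP.e23, map_zero]
  have Q10 : Q (0,1) (0,0) = 0 := by rw [hQ.good.herm (0,0), hQ.e01, map_zero]
  have Q20 : Q (1,0) (0,0) = 0 := by rw [hQ.good.herm (0,0), hQ.e02, map_zero]
  have Q31 : Q (1,1) (0,1) = 0 := by rw [hQ.good.herm (0,1), hQ.e13, map_zero]
  have Q32 : Q (1,1) (1,0) = 0 := by rw [hQ.good.herm (1,0), hQ.e23, map_zero]
  have P30 := hP.good.herm (0,0) (1,1)
  have Q30 := hQ.good.herm (0,0) (1,1)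
  have P21 := hP.good.herm (0,1) (1,0)
  have Q21 := hQ.good.herm (0,1) (1,0)
  rw [hP.e00, hP.e01, hP.e02, P30] at nP03
  rw [hQ.e00, hQ.e01, hQ.e02, Q30] at nQ03
  rw [hP.e11, hP.e13, P10, P21] at nP12
  rw [hQ.e11, hQ.e13, Q10, Q21] at nQ12
  obtain ⟨u, hu, hu'⟩ := exists_phase_s14 (P (0,0) (1,1)) (Q (0,0) (1,1)) (by
    change _ * (starRingEnd ℂ) _ = _ * (starRingEnd ℂ) _
    linear_combination nQ03 - nP03)
  obtain ⟨v, hv, hv'⟩ := exists_phase_s14 (P (0,1) (1,0)) (Q (0,1) (1,0)) (by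
    change _ * (starRingEnd ℂ) _ = _ * (starRingEnd ℂ) _
    linear_combination nQ12 - nP12)
  obtain ⟨e, he, he2⟩ := unit_sqrt (u * v) (by
    rw [star_mul]; linear_combination v * star v * hu + hv)
  have hu : u * (starRingEnd ℂ) u = 1 := hu
  have hv : v * (starRingEnd ℂ) v = 1 := hv
  have he : e * (starRingEnd ℂ) e = 1 := he
  have he2' := congrArg (starRingEnd ℂ) he2
  simp only [map_mul] at he2'
  have k2 : (u * (starRingEnd ℂ) e) * ((starRingEnd ℂ) u * e) = 1 := by
    linear_combination u * (starRingEnd ℂ) u * he + hu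
  have k1 : (starRingEnd ℂ) u * e * e = v := by
    linear_combination (starRingEnd ℂ) u * he2 + v * hu
  have k1' : u * (starRingEnd ℂ) e * (starRingEnd ℂ) e = (starRingEnd ℂ) v := by
    linear_combination u * he2' + (starRingEnd ℂ) v * hu
  refine ⟨!![1, 0; 0, (starRingEnd ℂ) e], !![1, 0; 0, (starRingEnd ℂ) u * e], uni_of _ _ _ _ ?_ ?_ ?_,
    uni_of _ _ _ _ ?_ ?_ ?_, ?_⟩
  · simp
  · simp
  · simp; linear_combination he
  · simp
  · simp
  · simp; linear_combination k2
  ext ⟨a, b⟩ ⟨c, d⟩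
  fin_cases a <;> fin_cases b <;> fin_cases c <;> fin_cases d <;>
    simp [kron2, Matrix.mul_apply, Fintype.sum_prod_type, Fin.sum_univ_two,
      Matrix.conjTranspose_apply, hP.e00, hP.e11, hP.e22, hP.e33, hP.e01, hP.e02, hP.e13, hP.e23,
      hQ.e00, hQ.e11, hQ.e22, hQ.e33, hQ.e01, hQ.e02, hQ.e13, hQ.e23, P10, P20, P31, P32, Q10, Q20, Q31, Q32,
      P30, Q30, P21, Q21, hu', hv']
  · linear_combination - u * P (0,0) (1,1) * he
  · linear_combination - ((1 + α - β) / 2) * k2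
  · linear_combination - P (0,1) (1,0) * k1
  · linear_combination - (starRingEnd ℂ) (P (0,1) (1,0)) * k1'
  · linear_combination - ((1 - α + β) / 2) * he
  · left; linear_combination - (starRingEnd ℂ) u * he
  · linear_combination - ((1 - α - β) / 2) * (k2 + (u * (starRingEnd ℂ) e) * ((starRingEnd ℂ) u * e) * he)

lemma TForm.eqs {P : M4} {α β : ℂ} (hT : TForm P α β) :
    P (0,1) (0,1) = 1 + α - P (0,0) (0,0) ∧ P (1,0) (1,0) = 1 + β - P (0,0) (0,0) ∧
    P (1,1) (1,1) = P (0,0) (0,0) - α - β ∧ P (1,0) (1,1) = - P (0,0) (0,1) ∧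
    P (0,1) (1,1) = - P (0,0) (1,0) ∧ P (1,1) (1,0) = - P (0,1) (0,0) ∧
    P (1,1) (0,1) = - P (1,0) (0,0) := by
  obtain ⟨h2, h1⟩ := hT
  have a00 := congrFun (congrFun h2 0) 0
  have a01 := congrFun (congrFun h2 0) 1
  have a10 := congrFun (congrFun h2 1) 0
  have a11 := congrFun (congrFun h2 1) 1
  have b00 := congrFun (congrFun h1 0) 0
  have b01 := congrFun (congrFun h1 0) 1
  have b10 := congrFun (congrFun h1 1) 0
  have b11 := congrFun (congrFun h1 1) 1
  simp [trace1, trace2, Fin.sum_univ_two] at a00 a01 a10 a11 b00 b01 b10 b11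
  refine ⟨?_, ?_, ?_, ?_, ?_, ?_, ?_⟩
  · linear_combination a00
  · linear_combination b00
  · linear_combination a11 - b00
  · linear_combination b01
  · linear_combination a01
  · linear_combination b10
  · linear_combination a10

lemma bloch {P : M4} {α β : ℂ} (hG : Good P) (hT : TForm P α β) :
    α * P (0,0) (0,1) = 0 ∧ β * P (0,0) (1,0) = 0 ∧
    α * (2 * P (0,0) (0,0) - 1 - α - β) = 0 ∧ β * (2 * P (0,0) (0,0) - 1 - α - β) = 0 ∧
    P (0,0) (1,1) * (2 * P (0,0) (0,0) - 1 - α - β) = 2 * P (0,0) (0,1) * P (0,0) (1,0) := by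
  obtain ⟨h11, h22, h33, h23, h13, h32, h31⟩ := hT.eqs
  have i00 := hG.idem (0,0) (0,0)
  have i11 := hG.idem (0,1) (0,1)
  have i22 := hG.idem (1,0) (1,0)
  have i33 := hG.idem (1,1) (1,1)
  have i01 := hG.idem (0,0) (0,1)
  have i02 := hG.idem (0,0) (1,0)
  have i03 := hG.idem (0,0) (1,1)
  have i13 := hG.idem (0,1) (1,1)
  have i23 := hG.idem (1,0) (1,1)
  rw [h11, h22, h33, h23, h13] at *
  rw [h32, h31] at *
  refine ⟨?_, ?_, ?_, ?_, ?_⟩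
  · linear_combination (i01 + i23) / 2
  · linear_combination (i02 + i13) / 2
  · linear_combination (i00 - i11 + i22 - i33) / 2
  · linear_combination (i00 + i11 - i22 - i33) / 2
  · linear_combination i03

lemma LU.of {P : M4} {U V : M2} (h : U ∈ Matrix.unitaryGroup (Fin 2) ℂ)
    (h' : V ∈ Matrix.unitaryGroup (Fin 2) ℂ) : LU P (kron2 U V * P * (kron2 U V)ᴴ) :=
  ⟨U, V, h, h', rfl⟩

lemma conj_smul_one {U : M2} (hU : U ∈ Matrix.unitaryGroup (Fin 2) ℂ) (N : M2) (c : ℂ)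
    (hN : N = c • (1 : M2)) : U * N * Uᴴ = c • (1 : M2) := by
  rw [hN]; simp [uni_r hU]

lemma caseA {P : M4} {α : ℂ} (hG : Good P) (hT : TForm P α 0)
    (hx : 2 * P (0,0) (0,0) - 1 - α = 0) (hm : P (0,0) (0,1) = 0) : ∃ P', LU P P' ∧ XF P' α 0 := by
  obtain ⟨h11, h22, h33, h23, h13, h32, h31⟩ := hT.eqs
  have h00 : P (0,0) (0,0) = (1 + α) / 2 := by linear_combination hx / 2
  have h10 : P (0,1) (0,0) = 0 := by rw [hG.herm (0,0), hm, map_zero]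
  obtain ⟨U, hU, hd, hd'⟩ := zero_diag (blk P 0 1) (by simp [blk, h13])
  have hG' := hG.conj (one_mem _) hU
  have B0 : blk P 0 0 = ((1 + α) / 2) • (1 : M2) := by
    ext i j; fin_cases i <;> fin_cases j <;> simp [blk, h11, h00, hm, h10]; ring
  have B1 : blk P 1 1 = ((1 - α) / 2) • (1 : M2) := by
    ext i j; fin_cases i <;> fin_cases j <;> simp [blk, h22, h33, h32, h23, h00, hm, h10] <;> ring
  have C0 := blk_conj P U 0 0
  have C1 := blk_conj P U 1 1
  rw [conj_smul_one hU _ _ B0] at C0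
  rw [conj_smul_one hU _ _ B1] at C1
  rw [← blk_conj] at hd hd'
  have e (i j) := congrFun (congrFun C0 i) j
  have f (i j) := congrFun (congrFun C1 i) j
  refine ⟨_, LU.of (one_mem _) hU, hG', ?_, ?_, ?_, ?_, ?_, hd, hd', ?_⟩
  · simpa [blk] using e 0 0
  · simpa [blk] using e 1 1
  · simpa [blk] using f 0 0
  · simpa [blk] using f 1 1
  · simpa [blk] using e 0 1
  · simpa [blk] using f 0 1

lemma caseB {P : M4} {β : ℂ} (hG : Good P) (hT : TForm P 0 β)
    (hx : 2 * P (0,0) (0,0) - 1 - β = 0) (hm : P (0,0) (1,0) = 0) : ∃ P', LU P P' ∧ XF P' 0 β := by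
  obtain ⟨h11, h22, h33, h23, h13, h32, h31⟩ := hT.eqs
  have h00 : P (0,0) (0,0) = (1 + β) / 2 := by linear_combination hx / 2
  have h10 : P (1,0) (0,0) = 0 := by rw [hG.herm (0,0), hm, map_zero]
  obtain ⟨U, hU, hd, hd'⟩ := zero_diag (blk' P 0 1) (by simp [blk', h23])
  have hG' := hG.conj hU (one_mem _)
  have B0 : blk' P 0 0 = ((1 + β) / 2) • (1 : M2) := by
    ext i j; fin_cases i <;> fin_cases j <;> simp [blk', h22, h00, hm, h10]; ring
  have B1 : blk' P 1 1 = ((1 - β) / 2) • (1 : M2) := by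
    ext i j; fin_cases i <;> fin_cases j <;> simp [blk', h11, h33, h31, h13, h00, hm, h10] <;> ring
  have C0 := blk'_conj P U 0 0
  have C1 := blk'_conj P U 1 1
  rw [conj_smul_one hU _ _ B0] at C0
  rw [conj_smul_one hU _ _ B1] at C1
  rw [← blk'_conj] at hd hd'
  have e (i j) := congrFun (congrFun C0 i) j
  have f (i j) := congrFun (congrFun C1 i) j
  refine ⟨_, LU.of hU (one_mem _), hG', ?_, ?_, ?_, ?_, hd, ?_, ?_, hd'⟩
  · simpa [blk'] using e 0 0
  · simpa [blk'] using f 0 0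
  · simpa [blk'] using e 1 1
  · simpa [blk'] using f 1 1
  · simpa [blk'] using e 0 1
  · simpa [blk'] using f 0 1

lemma toXF {P : M4} {α β : ℂ} (hG : Good P) (hT : TForm P α β) : ∃ P', LU P P' ∧ XF P' α β := by
  obtain ⟨b1, b2, b3, b4, b5⟩ := bloch hG hT
  by_cases hα : α = 0
  · by_cases hβ : β = 0
    · subst hα hβ
      obtain ⟨h11, h22, h33, h23, h13, h32, h31⟩ := hT.eqs
      obtain ⟨U, hU, hd, hd'⟩ := zero_diag (blk P 0 0 - (1 / 2 : ℂ) • (1 : M2))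
        (by simp [blk, h11]; ring)
      have hG' := hG.conj (one_mem _) hU
      have hT' : TForm (kron2 1 U * P * (kron2 1 U)ᴴ) 0 0 := by
        constructor
        · rw [trace2_conj P hU, hT.1]; simp
        · rw [trace1_conj P (one_mem _), hT.2]
          have : (Matrix.diagonal ![(1:ℂ) + 0, 1 - 0] : M2) = 1 := by
            ext i j; fin_cases i <;> fin_cases j <;> simp
          rw [this, Matrix.mul_one, uni_r hU]
      have hx : (blk (kron2 1 U * P * (kron2 1 U)ᴴ) 0 0) 0 0 = 1 / 2 := by
        rw [blk_conj]
        rw [Matrix.mul_sub, Matrix.sub_mul, conj_smul_one hU _ _ rfl] at hd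
        simp at hd
        linear_combination hd
      have hx' : 2 * (kron2 1 U * P * (kron2 1 U)ᴴ) (0,0) (0,0) - 1 - 0 = 0 := by
        change 2 * (blk (kron2 1 U * P * (kron2 1 U)ᴴ) 0 0) 0 0 - 1 - 0 = 0
        rw [hx]; norm_num
      have hLU : LU P (kron2 1 U * P * (kron2 1 U)ᴴ) := LU.of (one_mem _) hU
      generalize kron2 1 U * P * (kron2 1 U)ᴴ = P' at *
      obtain ⟨-, -, -, -, c⟩ := bloch hG' hT'
      rw [hx', sub_zero, mul_zero] at c
      have : P' (0,0) (0,1) = 0 ∨ P' (0,0) (1,0) = 0 := by simpa using c.symm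
      rcases this with h | h
      · obtain ⟨R, hR, hR'⟩ := caseA hG' hT' hx' h
        exact ⟨R, hLU.trans hR, hR'⟩
      · obtain ⟨R, hR, hR'⟩ := caseB hG' hT' hx' h
        exact ⟨R, hLU.trans hR, hR'⟩
    · subst hα
      simp only [mul_eq_zero, hβ, false_or] at b2 b4
      exact caseB hG hT (by linear_combination b4) b2
  · simp only [mul_eq_zero, hα, false_or] at b1 b3
    by_cases hβ : β = 0
    · subst hβ
      exact caseA hG hT (by linear_combination b3) b1
    · simp only [mul_eq_zero, hβ, false_or] at b2
      obtain ⟨h11, h22, h33, h23, h13, h32, h31⟩ := hT.eqs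
      refine ⟨P, ⟨1, 1, one_mem _, one_mem _, by simp [kron2_one]⟩, hG, ?_, ?_, ?_, ?_, b1, b2, ?_, ?_⟩
      · linear_combination b3 / 2
      · rw [h11]; linear_combination -b3 / 2
      · rw [h22]; linear_combination -b3 / 2
      · rw [h33]; linear_combination b3 / 2
      · rw [h13, b2, neg_zero]
      · rw [h23, b1, neg_zero]

lemma trace_of_rank {P : M4} (h : P * P = P) (hr : P.rank = 2) : P.trace = 2 := by
  have hi : IsIdempotentElem (Matrix.toLin' P) := by
    unfold IsIdempotentElem
    rw [Module.End.mul_eq_comp, ← Matrix.toLin'_mul, h]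
  have := (LinearMap.IsIdempotentElem.isProj_range _ hi).trace
  rw [Matrix.trace_toLin'_eq] at this
  rw [this]
  have h2 : Module.finrank ℂ (LinearMap.range (Matrix.toLin' P)) = 2 := hr
  rw [h2]; norm_num

lemma exists_diag_s14 {H : M2} (hH : H.IsHermitian) (ht : H.trace = 2) :
    ∃ U ∈ Matrix.unitaryGroup (Fin 2) ℂ, ∃ α : ℂ, U * H * Uᴴ = Matrix.diagonal ![1 + α, 1 - α] ∧
      spectrum ℂ H = {1 + α, 1 - α} := by
  set V := hH.eigenvectorUnitary
  have hV := V.2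
  have hs := hH.spectral_theorem
  rw [Unitary.conjStarAlgAut_apply] at hs
  set D : M2 := Matrix.diagonal (RCLike.ofReal ∘ hH.eigenvalues) with hD
  have h1 : (V : M2)ᴴ * H * V = D := by
    have hl := uni_l hV
    calc (V : M2)ᴴ * H * V = ((V : M2)ᴴ * V) * D * ((V : M2)ᴴ * V) := by
          conv_lhs => rw [hs]
          rw [Matrix.star_eq_conjTranspose]; simp only [Matrix.mul_assoc]; rfl
      _ = D := by rw [hl]; simp
  have hsum := hH.trace_eq_sum_eigenvalues
  rw [ht, Fin.sum_univ_two] at hsum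
  have hDD : D = Matrix.diagonal ![1 + ((hH.eigenvalues 0 : ℂ) - 1), 1 - ((hH.eigenvalues 0 : ℂ) - 1)] := by
    rw [hD]; congr 1
    ext i; fin_cases i
    · simp
    · simp; simp at hsum; linear_combination -hsum
  refine ⟨(V : M2)ᴴ, Unitary.star_mem hV, (hH.eigenvalues 0 : ℂ) - 1, ?_, ?_⟩
  · rw [conjTranspose_conjTranspose, h1, hDD]
  · have : spectrum ℂ H = spectrum ℂ D := by
      conv_lhs => rw [hs]
      exact Unitary.spectrum_star_right_conjugate
    rw [this, hDD, spectrum_diagonal]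
    simp [Set.pair_comm]

lemma swap_mem : (!![0, 1; 1, 0] : M2) ∈ Matrix.unitaryGroup (Fin 2) ℂ :=
  uni_of _ _ _ _ (by simp) (by simp) (by simp)

lemma common_diag {H K : M2} (hH : H.IsHermitian) (ht : H.trace = 2) (hK : K.IsHermitian)
    (kt : K.trace = 2) (hs : spectrum ℂ H = spectrum ℂ K) :
    ∃ U ∈ Matrix.unitaryGroup (Fin 2) ℂ, ∃ V ∈ Matrix.unitaryGroup (Fin 2) ℂ, ∃ α : ℂ,
      U * H * Uᴴ = Matrix.diagonal ![1 + α, 1 - α] ∧ V * K * Vᴴ = Matrix.diagonal ![1 + α, 1 - α] := by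
  obtain ⟨U, hU, α, h1, h2⟩ := exists_diag_s14 hH ht
  obtain ⟨V, hV, β, k1, k2⟩ := exists_diag_s14 hK kt
  rw [h2, k2] at hs
  have hm : (1 + α) ∈ ({1 + β, 1 - β} : Set ℂ) := by rw [← hs]; simp
  simp only [Set.mem_insert_iff, Set.mem_singleton_iff] at hm
  rcases hm with hm | hm
  · have : α = β := by linear_combination hm
    subst this
    exact ⟨U, hU, V, hV, α, h1, k1⟩
  · have : β = -α := by linear_combination hm
    subst this
    refine ⟨U, hU, !![0, 1; 1, 0] * V, mul_mem swap_mem hV, α, h1, ?_⟩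
    have : !![0, 1; 1, 0] * V * K * (!![0, 1; 1, 0] * V)ᴴ
        = !![0, 1; 1, 0] * (V * K * Vᴴ) * (!![0, 1; 1, 0] : M2)ᴴ := by
      rw [conjTranspose_mul]; simp only [Matrix.mul_assoc]
    rw [this, k1]
    ext i j
    rw [conj_entry]
    fin_cases i <;> fin_cases j <;> simp [sub_eq_add_neg]

lemma trace2_props {P : M4} (hP : P.IsHermitian) (ht : P.trace = 2) :
    (trace2 P).IsHermitian ∧ (trace2 P).trace = 2 ∧ (trace1 P).IsHermitian ∧ (trace1 P).trace = 2 := by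
  simp [Matrix.trace, Fintype.sum_prod_type, Fin.sum_univ_two] at ht
  refine ⟨?_, ?_, ?_, ?_⟩
  · ext i j
    simp only [trace2, Matrix.conjTranspose_apply, Matrix.of_apply, star_sum]
    exact Finset.sum_congr rfl fun b _ => hP.apply _ _
  · simp [Matrix.trace, trace2, Fin.sum_univ_two]; linear_combination ht
  · ext i j
    simp only [trace1, Matrix.conjTranspose_apply, Matrix.of_apply, star_sum]
    exact Finset.sum_congr rfl fun b _ => hP.apply _ _
  · simp [Matrix.trace, trace1, Fin.sum_univ_two]; linear_combination ht

/-- two rank-2 orthogonal projections on `ℂ²⊗ℂ²` whose partial traces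
have the same eigenvalues are conjugate by a local unitary `U₁⊗U₂`. -/
theorem rank_two_projections_with_equal_partial_trace_spectra_are_locally_unitarily_equivalent
    (P Q : Matrix (Fin 2 × Fin 2) (Fin 2 × Fin 2) ℂ)
    (hPherm : P.IsHermitian) (hPproj : P * P = P) (hPrank : P.rank = 2)
    (hQherm : Q.IsHermitian) (hQproj : Q * Q = Q) (hQrank : Q.rank = 2)
    (h2 : spectrum ℂ (trace2 P) = spectrum ℂ (trace2 Q))
    (h1 : spectrum ℂ (trace1 P) = spectrum ℂ (trace1 Q)) :
    ∃ U1 U2 : Matrix (Fin 2) (Fin 2) ℂ,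
      U1 ∈ Matrix.unitaryGroup (Fin 2) ℂ ∧ U2 ∈ Matrix.unitaryGroup (Fin 2) ℂ ∧
      Q = kron2 U1 U2 * P * (kron2 U1 U2).conjTranspose := by
  obtain ⟨p1, p2, p3, p4⟩ := trace2_props hPherm (trace_of_rank hPproj hPrank)
  obtain ⟨q1, q2, q3, q4⟩ := trace2_props hQherm (trace_of_rank hQproj hQrank)
  obtain ⟨U1, hU1, V1, hV1, α, a1, a2⟩ := common_diag p1 p2 q1 q2 h2
  obtain ⟨U2, hU2, V2, hV2, β, b1, b2⟩ := common_diag p3 p4 q3 q4 h1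
  have gP : Good P := ⟨hPherm, hPproj⟩
  have gQ : Good Q := ⟨hQherm, hQproj⟩
  obtain ⟨P', hP', xP⟩ := toXF (α := α) (β := β) (gP.conj hU1 hU2)
    ⟨by rw [trace2_conj P hU2, a1], by rw [trace1_conj P hU1, b1]⟩
  obtain ⟨Q', hQ', xQ⟩ := toXF (α := α) (β := β) (gQ.conj hV1 hV2)
    ⟨by rw [trace2_conj Q hV2, a2], by rw [trace1_conj Q hV1, b2]⟩
  exact (((LU.of hU1 hU2).trans hP').trans (xP.lu xQ)).trans (((LU.of hV1 hV2).trans hQ').symm)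
end
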